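/- Let H_k be a super spherical harmonic of degree k and let O = Δ + x² + 2𝔼 + M, where x² denotes multiplication by Σ_{j=1}^n x`_{2j−1} x`_{2j} − Σ_{j=1}^m x_j². Then the functions ψ_{j,k} = O^j(H_k · exp(x²/2)) are eigenfunctions of the super Fourier transform: F^±_{m|2n}(ψ_{j,k}) = e^{±i(2j+k)π/2} · ψ_{j,k}(y) = (±i)^{2j+k} ψ_{j,k}(y), for every integer j ≥ 0. -/

import Mathlib

open scoped BigOperators
open Finset MeasureTheory

noncomputable section

/-- The Grassmann algebra on `N` anticommuting generators with coefficients in a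
commutative ring `R`, represented by its coefficients with respect to the basis of
increasingly-ordered monomials, indexed by subsets of the generators. -/
abbrev Gr (R : Type) (N : ℕ) : Type := Finset (Fin N) → R

namespace Gr

variable {R : Type} [CommRing R] {N : ℕ}

/-- The sign produced when reordering the concatenation of the ordered monomials indexed
by `A` and `B` into the ordered monomial indexed by `A ∪ B`. -/
def msign (A B : Finset (Fin N)) : R :=
  (-1 : R) ^ (((A ×ˢ B).filter fun p => p.2 < p.1).card)

/-- Multiplication of the Grassmann algebra. -/
def mul (f g : Gr R N) : Gr R N :=
  fun s => ∑ A ∈ s.powerset, msign A (s \ A) * f A * g (s \ A)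

/-- The unit of the Grassmann algebra. -/
def one : Gr R N := fun s => if s = (∅ : Finset (Fin N)) then 1 else 0

/-- The `j`-th generator of the Grassmann algebra. -/
def gen (j : Fin N) : Gr R N := fun s => if s = {j} then 1 else 0

/-- Powers in the Grassmann algebra. -/
def pow (f : Gr R N) : ℕ → Gr R N
  | 0 => one
  | k + 1 => mul (pow f k) f

/-- The left partial derivative `∂_j`, i.e. the odd derivation with `∂_j(x_k) = δ_{jk}`. -/
def pderiv (j : Fin N) (f : Gr R N) : Gr R N :=
  fun s => if j ∈ s then 0
    else (-1 : R) ^ ((s.filter fun i => i < j).card) * f (insert j s)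

/-- The exponential of a Grassmann algebra element with nilpotent (zero-constant-term)
argument: the series terminates, and all terms beyond degree `N` vanish. -/
def gexp (f : Gr ℂ N) : Gr ℂ N :=
  ∑ k ∈ Finset.range (N + 1), ((k.factorial : ℂ))⁻¹ • pow f k

/-- Iterated left partial derivatives: the first element of the list acts first. -/
def derivList (l : List (Fin N)) (f : Gr R N) : Gr R N :=
  l.foldl (fun g j => pderiv j g) f

/-- Complex conjugation of the coefficients. -/
def gconj (f : Gr ℂ N) : Gr ℂ N := fun s => (starRingEnd ℂ) (f s)

end Gr

/-- The Lean index of the paper's generator `x`_{2j-1}` (j = 1,…,n). -/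
def lo (n : ℕ) (j : Fin n) : Fin (2 * n) := ⟨2 * (j : ℕ), by have := j.isLt; omega⟩

/-- The Lean index of the paper's generator `x`_{2j}` (j = 1,…,n). -/
def hi (n : ℕ) (j : Fin n) : Fin (2 * n) := ⟨2 * (j : ℕ) + 1, by have := j.isLt; omega⟩

/-- `x`² = Σ_{j=1}^n x`_{2j-1} x`_{2j}`. -/
def xsq (n : ℕ) : Gr ℂ (2 * n) := ∑ j : Fin n, Gr.mul (Gr.gen (lo n j)) (Gr.gen (hi n j))

/-- The fermionic Laplace operator `Δ_f = 4 Σ_{j=1}^n ∂_{x`_{2j-1}} ∂_{x`_{2j}}`. -/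
def lapF (n : ℕ) (f : Gr ℂ (2 * n)) : Gr ℂ (2 * n) :=
  (4 : ℂ) • ∑ j : Fin n, Gr.pderiv (lo n j) (Gr.pderiv (hi n j) f)

/-- The Berezin integral `∫_B = π^{-n} ∂_{x`_{2n}} ⋯ ∂_{x`_1}`. -/
def berezin (n : ℕ) (f : Gr ℂ (2 * n)) : ℂ :=
  ((Real.pi : ℂ) ^ n)⁻¹ * Gr.derivList (List.finRange (2 * n)) f ∅

/-- The fermionic Gaussian `exp(x`²/2) = Σ_{j=0}^n (x`²)^j/(2^j j!)`. -/
def fermGauss (n : ℕ) : Gr ℂ (2 * n) :=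
  ∑ j ∈ Finset.range (n + 1), (((2 : ℂ) ^ j * j.factorial)⁻¹) • Gr.pow (xsq n) j

/-- Embedding of the `x` generators into the Grassmann algebra on the `4n` generators
`x`_1, …, x`_{2n}, y`_1, …, y`_{2n}` (the `x` generators come first). -/
def xi (n : ℕ) (t : Fin (2 * n)) : Fin (2 * n + 2 * n) := Fin.castAdd (2 * n) t

/-- Embedding of the `y` generators into the Grassmann algebra on the `4n` generators. -/
def yi (n : ℕ) (t : Fin (2 * n)) : Fin (2 * n + 2 * n) := Fin.natAdd (2 * n) t

/-- The algebra embedding `Λ_{2n} → Λ_{4n}` sending the generators to the `x` generators. -/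
def embX (n : ℕ) (f : Gr ℂ (2 * n)) : Gr ℂ (2 * n + 2 * n) :=
  fun s => ∑ A : Finset (Fin (2 * n)), if s = A.image (xi n) then f A else 0

/-- The Berezin integral with respect to the `x` variables,
`π^{-n} ∂_{x`_{2n}} ⋯ ∂_{x`_1}`, inside the mixed algebra `Λ_{4n}`. -/
def berezinX (n : ℕ) (F : Gr ℂ (2 * n + 2 * n)) : Gr ℂ (2 * n + 2 * n) :=
  ((Real.pi : ℂ) ^ n)⁻¹ • Gr.derivList ((List.finRange (2 * n)).map (xi n)) F

/-- The fermionic Fourier kernel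
`K^σ(x, y) = exp(-σ (i/2) Σ_{j=1}^n (x`_{2j-1} y`_{2j} - x`_{2j} y`_{2j-1}))`
(for the plus sign `σ = 1`, for the minus sign `σ = -1`). -/
def fermK (n : ℕ) (σ : ℂ) : Gr ℂ (2 * n + 2 * n) :=
  Gr.gexp ((-σ * (Complex.I / 2)) • ∑ j : Fin n,
    (Gr.mul (Gr.gen (xi n (lo n j))) (Gr.gen (yi n (hi n j))) -
     Gr.mul (Gr.gen (xi n (hi n j))) (Gr.gen (yi n (lo n j)))))

/-- The fermionic Fourier transform
`F^σ_{0|2n}(g)(y) = (2π)^n ∫_{B,x} K^σ(x,y) g(x)`, an element of the Grassmann algebra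
in the `y` variables, identified with `Λ_{2n}`. -/
def fermFT (n : ℕ) (σ : ℂ) (g : Gr ℂ (2 * n)) : Gr ℂ (2 * n) :=
  fun s => (((2 * Real.pi : ℝ) : ℂ) ^ n) *
    berezinX n (Gr.mul (fermK n σ) (embX n g)) (s.image (yi n))


end
noncomputable section

/-- Functions on `ℝ^m` with values in the Grassmann algebra `Λ_{2n}`; the elements with
Schwartz coefficients form the space `S(ℝ^m)_{m|2n}`. -/
abbrev SF (m n : ℕ) : Type := ((Fin m) → ℝ) → Gr ℂ (2 * n)

/-- `f ∈ S(ℝ^m)_{m|2n}`: every Grassmann coefficient of `f` is a Schwartz function. -/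
def IsSchwartz (m n : ℕ) (f : SF m n) : Prop :=
  ∀ s : Finset (Fin (2 * n)), ∃ φ : SchwartzMap ((Fin m) → ℝ) ℂ, ∀ x, f x s = φ x

/-- The super Fourier transform
`F^σ_{m|2n}(f)(y) = (2π)^{-M/2} ∫_{ℝ^m} dV(x) ∫_{B,x} exp(σ i Σ_i x_i y_i) K^σ(x,y) f(x)`,
with `M = m - 2n` (plus sign: `σ = 1`; minus sign: `σ = -1`). -/
def superFT (m n : ℕ) (σ : ℂ) (f : SF m n) : SF m n :=
  fun y s => (((2 * Real.pi : ℝ) : ℂ) ^ ((-((m : ℂ) - 2 * (n : ℂ))) / 2)) *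
    ∫ x : (Fin m) → ℝ, Complex.exp (σ * Complex.I * ∑ i, (x i : ℂ) * (y i : ℂ)) *
      berezinX n (Gr.mul (fermK n σ) (embX n (f x))) (s.image (yi n))

/-- The partial derivative `∂_{x_i}` of a `Λ_{2n}`-valued function, acting coefficientwise. -/
def bderiv (m n : ℕ) (i : Fin m) (f : SF m n) : SF m n :=
  fun x s => fderiv ℝ (fun t => f t s) x (Pi.single i 1)

/-- The super Laplace operator `Δ = 4 Σ_j ∂_{x`_{2j-1}} ∂_{x`_{2j}} - Σ_j ∂_{x_j}²`. -/
def superLap (m n : ℕ) (f : SF m n) : SF m n :=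
  fun x => lapF n (f x) - ∑ i : Fin m, bderiv m n i (bderiv m n i f) x

/-- The element `x² = Σ_{j=1}^n x`_{2j-1} x`_{2j} - Σ_{j=1}^m x_j²` at the point `x`. -/
def xsqElem (m n : ℕ) (x : (Fin m) → ℝ) : Gr ℂ (2 * n) :=
  xsq n + (-(∑ i : Fin m, ((x i : ℂ)) ^ 2)) • Gr.one

/-- The super Gaussian `exp(x²/2) = exp(-(x_1²+⋯+x_m²)/2) Σ_{j=0}^n (x`²)^j/(2^j j!)`. -/
def gaussFun (m n : ℕ) : SF m n :=
  fun x => ((Real.exp (-(∑ i : Fin m, (x i) ^ 2) / 2) : ℝ) : ℂ) • fermGauss n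

/-- The Euler operator `𝔼 = Σ_j x_j ∂_{x_j} + Σ_j x`_j ∂_{x`_j}`. -/
def euler (m n : ℕ) (f : SF m n) : SF m n :=
  fun x => (∑ i : Fin m, ((x i : ℂ)) • bderiv m n i f x) +
    ∑ t : Fin (2 * n), Gr.mul (Gr.gen t) (Gr.pderiv t (f x))

/-- The super integral `∫_{ℝ^{m|2n}} f = ∫_{ℝ^m} dV(x) ∫_B f`. -/
def superInt (m n : ℕ) (f : SF m n) : ℂ := ∫ x : (Fin m) → ℝ, berezin n (f x)

end
noncomputable section

/-- Elements of `ℂ[x_1,…,x_m] ⊗ Λ_{2n}`: Grassmann elements whose coefficients are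
polynomials in the commuting variables. -/
abbrev PG (m n : ℕ) : Type := Gr (MvPolynomial (Fin m) ℂ) (2 * n)

/-- `H` is homogeneous of total degree `l`, counting both commuting and
anticommuting variables. -/
def PHomog (m n : ℕ) (H : PG m n) (l : ℕ) : Prop :=
  ∀ s : Finset (Fin (2 * n)), ∀ d ∈ (H s).support, (d.sum fun _ e => e) + s.card = l

/-- The super Laplace operator `Δ = 4 Σ_j ∂_{x`_{2j-1}} ∂_{x`_{2j}} - Σ_j ∂_{x_j}²`
on `ℂ[x_1,…,x_m] ⊗ Λ_{2n}`. -/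
def superLapP (m n : ℕ) (H : PG m n) : PG m n :=
  fun s => (4 : MvPolynomial (Fin m) ℂ) *
      (∑ j : Fin n, Gr.pderiv (lo n j) (Gr.pderiv (hi n j) H) s)
    - ∑ i : Fin m, MvPolynomial.pderiv i (MvPolynomial.pderiv i (H s))

/-- Evaluation of an element of `ℂ[x_1,…,x_m] ⊗ Λ_{2n}` at the point `x ∈ ℝ^m`,
giving a `Λ_{2n}`-valued function. -/
def evalP (m n : ℕ) (H : PG m n) : SF m n :=
  fun x s => MvPolynomial.eval (fun i => ((x i : ℝ) : ℂ)) (H s)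

end

noncomputable section

/-- The scalar operator `O = Δ + x² + 2𝔼 + M` (with `M = m - 2n` the super-dimension),
acting on `Λ_{2n}`-valued functions on `ℝ^m`. -/
def Oop (m n : ℕ) (F : SF m n) : SF m n :=
  fun x => superLap m n F x + Gr.mul (xsqElem m n x) (F x) + (2 : ℂ) • euler m n F x +
    (((m : ℂ) - 2 * (n : ℂ))) • F x

namespace Gr

section Algebra

variable {R : Type} [CommRing R] {N : ℕ}

theorem neg_one_pow_card_filter {ι : Type} (s : Finset ι) (p : ι → Prop) [DecidablePred p] :
    (-1 : R) ^ (s.filter p).card = ∏ i ∈ s, if p i then (-1 : R) else 1 := by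
  rw [Finset.prod_ite]; simp

/-- The sign picked up when moving the generator `t` past the monomial indexed by `s`. -/
def lsign (t : Fin N) (s : Finset (Fin N)) : R := ∏ b ∈ s, if b < t then (-1 : R) else 1

theorem msign_eq_prod (A B : Finset (Fin N)) : (msign A B : R) = ∏ a ∈ A, lsign a B := by
  unfold msign lsign
  rw [neg_one_pow_card_filter, Finset.prod_product]

theorem lsign_mul_self (t : Fin N) (s : Finset (Fin N)) :
    (lsign t s * lsign t s : R) = 1 := by
  unfold lsign
  rw [← Finset.prod_mul_distrib]
  exact Finset.prod_eq_one fun i _ => by split_ifs <;> simp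

theorem lsign_union (t : Fin N) {A B : Finset (Fin N)} (h : Disjoint A B) :
    (lsign t (A ∪ B) : R) = lsign t A * lsign t B :=
  Finset.prod_union h

theorem lsign_insert (t : Fin N) {u : Fin N} {s : Finset (Fin N)} (h : u ∉ s) :
    (lsign t (insert u s) : R) = (if u < t then -1 else 1) * lsign t s :=
  Finset.prod_insert h

theorem msign_union_left {A B : Finset (Fin N)} (C : Finset (Fin N)) (h : Disjoint A B) :
    (msign (A ∪ B) C : R) = msign A C * msign B C := by
  simp only [msign_eq_prod, Finset.prod_union h]

theorem msign_union_right (A : Finset (Fin N)) {B C : Finset (Fin N)} (h : Disjoint B C) :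
    (msign A (B ∪ C) : R) = msign A B * msign A C := by
  simp only [msign_eq_prod, lsign_union _ h, Finset.prod_mul_distrib]

theorem msign_swap {A B : Finset (Fin N)} (h : Disjoint A B) :
    (msign A B : R) = (-1) ^ (A.card * B.card) * msign B A := by
  have h1 : (msign B A : R) = ∏ a ∈ A, ∏ b ∈ B, if a < b then (-1 : R) else 1 := by
    rw [msign_eq_prod]; exact Finset.prod_comm
  rw [h1, msign_eq_prod, mul_comm A.card, pow_mul, ← Finset.prod_const, ← Finset.prod_mul_distrib]
  refine Finset.prod_congr rfl fun a ha => ?_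
  rw [← Finset.prod_const, ← Finset.prod_mul_distrib, lsign]
  refine Finset.prod_congr rfl fun b hb => ?_
  have hab : a ≠ b := fun e => Finset.disjoint_left.1 h ha (e ▸ hb)
  rcases lt_or_gt_of_ne hab with h' | h'
  · simp [h', h'.not_gt]
  · simp [h', h'.not_gt]

theorem msign_singleton_left (t : Fin N) (B : Finset (Fin N)) :
    (msign {t} B : R) = lsign t B := by
  simp [msign_eq_prod]

theorem msign_empty_left (B : Finset (Fin N)) : (msign ∅ B : R) = 1 := by simp [msign]

theorem lsign_erase_self (t : Fin N) (s : Finset (Fin N)) :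
    (lsign t (s.erase t) : R) = lsign t s := by
  by_cases h : t ∈ s
  · conv_rhs => rw [← Finset.insert_erase h, lsign_insert _ (Finset.notMem_erase t s)]
    simp
  · rw [Finset.erase_eq_of_notMem h]

theorem pderiv_apply (t : Fin N) (f : Gr R N) (s : Finset (Fin N)) :
    pderiv t f s = if t ∈ s then 0 else lsign t s * f (insert t s) := by
  simp only [pderiv, lsign, neg_one_pow_card_filter]

theorem gen_mul_apply (t : Fin N) (f : Gr R N) (s : Finset (Fin N)) :
    mul (gen t) f s = if t ∈ s then lsign t s * f (s.erase t) else 0 := by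
  unfold mul gen
  split_ifs with h
  · rw [Finset.sum_eq_single {t}]
    · simp [msign_singleton_left, Finset.sdiff_singleton_eq_erase, lsign_erase_self]
    · intro b _ hb; simp [hb]
    · intro h'; simp [h] at h'
  · refine Finset.sum_eq_zero fun A hA => ?_
    rw [if_neg, mul_zero, zero_mul]
    rintro rfl
    exact h (by simpa using hA)

/-- Multiplication of the Grassmann algebra as a bilinear map. -/
def mulL : Gr R N →ₗ[R] Gr R N →ₗ[R] Gr R N :=
  LinearMap.mk₂ R mul
    (fun f g h => by ext s; simp [mul, mul_add, add_mul, Finset.sum_add_distrib])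
    (fun c f g => by
      ext s; simp only [mul, Pi.smul_apply, smul_eq_mul, Finset.mul_sum]
      exact Finset.sum_congr rfl fun _ _ => by ring)
    (fun f g h => by ext s; simp [mul, mul_add, Finset.sum_add_distrib])
    (fun c f g => by
      ext s; simp only [mul, Pi.smul_apply, smul_eq_mul, Finset.mul_sum]
      exact Finset.sum_congr rfl fun _ _ => by ring)

theorem mulL_apply (f g : Gr R N) : mulL f g = mul f g := rfl

theorem add_mul (f g h : Gr R N) : mul (f + g) h = mul f h + mul g h := mulL.map_add₂ f g h

theorem mul_add (f g h : Gr R N) : mul f (g + h) = mul f g + mul f h := (mulL f).map_add g h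

theorem smul_mul (c : R) (f g : Gr R N) : mul (c • f) g = c • mul f g := mulL.map_smul₂ c f g

theorem mul_smul (c : R) (f g : Gr R N) : mul f (c • g) = c • mul f g := (mulL f).map_smul c g

theorem sum_mul {ι : Type} (I : Finset ι) (f : ι → Gr R N) (g : Gr R N) :
    mul (∑ i ∈ I, f i) g = ∑ i ∈ I, mul (f i) g := by
  simp only [← mulL_apply, map_sum, LinearMap.sum_apply]

theorem mul_sum {ι : Type} (I : Finset ι) (f : Gr R N) (g : ι → Gr R N) :
    mul f (∑ i ∈ I, g i) = ∑ i ∈ I, mul f (g i) :=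
  map_sum (mulL f) g I

/-- The left partial derivative as a linear map. -/
def pderivL (t : Fin N) : Gr R N →ₗ[R] Gr R N where
  toFun := pderiv t
  map_add' f g := by
    ext s; simp only [pderiv_apply, Pi.add_apply]; split_ifs <;> ring
  map_smul' c f := by
    ext s; simp only [pderiv_apply, Pi.smul_apply, smul_eq_mul, RingHom.id_apply]
    split_ifs <;> ring

theorem pderiv_add (t : Fin N) (f g : Gr R N) : pderiv t (f + g) = pderiv t f + pderiv t g :=
  (pderivL t).map_add f g

theorem pderiv_smul (t : Fin N) (c : R) (f : Gr R N) : pderiv t (c • f) = c • pderiv t f :=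
  (pderivL t).map_smul c f

theorem pderiv_sum {ι : Type} (t : Fin N) (I : Finset ι) (f : ι → Gr R N) :
    pderiv t (∑ i ∈ I, f i) = ∑ i ∈ I, pderiv t (f i) :=
  map_sum (pderivL t) f I

theorem one_mul (f : Gr R N) : mul one f = f := by
  ext s
  unfold mul one
  rw [Finset.sum_eq_single ∅]
  · simp [msign_empty_left]
  · intro b _ hb; simp [hb]
  · simp

theorem mul_assoc (f g h : Gr R N) : mul (mul f g) h = mul f (mul g h) := by
  ext s
  simp only [mul, Finset.mul_sum, Finset.sum_mul]
  rw [Finset.sum_sigma', Finset.sum_sigma']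
  refine Finset.sum_bij' (fun p _ => ⟨p.2, p.1 \ p.2⟩) (fun p _ => ⟨p.1 ∪ p.2, p.1⟩) ?_ ?_ ?_ ?_ ?_
  · rintro ⟨A, B⟩ h
    simp only [Finset.mem_sigma, Finset.mem_powerset] at h ⊢
    exact ⟨h.2.trans h.1, Finset.sdiff_subset_sdiff h.1 subset_rfl⟩
  · rintro ⟨A, B⟩ h
    simp only [Finset.mem_sigma, Finset.mem_powerset] at h ⊢
    exact ⟨Finset.union_subset h.1 (h.2.trans Finset.sdiff_subset), Finset.subset_union_left⟩
  · rintro ⟨A, B⟩ h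
    simp only [Finset.mem_sigma, Finset.mem_powerset] at h ⊢
    simp [Finset.union_sdiff_of_subset h.2]
  · rintro ⟨A, B⟩ h
    simp only [Finset.mem_sigma, Finset.mem_powerset] at h ⊢
    have : Disjoint A B := (Finset.disjoint_sdiff.mono_right h.2)
    simp [Finset.union_sdiff_cancel_left this]
  · rintro ⟨A, B⟩ h
    simp only [Finset.mem_sigma, Finset.mem_powerset] at h ⊢
    have e1 : (s \ B) \ (A \ B) = s \ A := by
      ext i; have := @h.2 i; simp only [Finset.mem_sdiff]; tauto
    have e2 : s \ B = (A \ B) ∪ (s \ A) := by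
      ext i; have := @h.2 i; have := @h.1 i; simp only [Finset.mem_sdiff, Finset.mem_union]; tauto
    have d2 : Disjoint (A \ B) (s \ A) := Finset.disjoint_sdiff.mono_left Finset.sdiff_subset
    have e3 : (msign A (s \ A) : R) = msign B (s \ A) * msign (A \ B) (s \ A) := by
      conv_lhs => rw [← Finset.union_sdiff_of_subset h.2]
      rw [Finset.union_sdiff_of_subset h.2, ← msign_union_left _ Finset.disjoint_sdiff,
        Finset.union_sdiff_of_subset h.2]
    rw [e1, e3, e2, msign_union_right _ d2]
    ring

/-- The grade involution. -/
def parity (f : Gr R N) : Gr R N := fun s => (-1) ^ s.card * f s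

theorem msign_insert_left {t : Fin N} {A : Finset (Fin N)} (B : Finset (Fin N)) (h : t ∉ A) :
    (msign (insert t A) B : R) = lsign t B * msign A B := by
  rw [msign_eq_prod, Finset.prod_insert h, msign_eq_prod]

theorem msign_insert_right {t : Fin N} {A B : Finset (Fin N)} (hA : t ∉ A) (hB : t ∉ B) :
    (msign A (insert t B) : R) = (-1) ^ A.card * lsign t A * msign A B := by
  rw [Finset.insert_eq, msign_union_right _ (Finset.disjoint_singleton_left.2 hB),
    msign_swap (Finset.disjoint_singleton_right.2 hA), msign_singleton_left]
  simp

theorem pderiv_mul (t : Fin N) (f g : Gr R N) :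
    pderiv t (mul f g) = mul (pderiv t f) g + mul (parity f) (pderiv t g) := by
  have key (s : Finset (Fin N)) (ht : t ∉ s) (A : Finset (Fin N)) (hA : A ∈ s.powerset) :
      t ∉ A ∧ t ∉ s \ A ∧ insert t s \ A = insert t (s \ A) ∧
        insert t s \ insert t A = s \ A ∧
        (lsign t s : R) = lsign t A * lsign t (s \ A) := by
    rw [Finset.mem_powerset] at hA
    have hA' : t ∉ A := fun h => ht (hA h)
    refine ⟨hA', fun h => ht (Finset.sdiff_subset h), Finset.insert_sdiff_of_notMem _ hA', ?_, ?_⟩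
    · ext i; simp only [Finset.mem_sdiff, Finset.mem_insert]
      by_cases hi : i = t <;> simp [hi, ht]
    · rw [← lsign_union _ Finset.disjoint_sdiff, Finset.union_sdiff_of_subset hA]
  ext s
  rw [pderiv_apply, Pi.add_apply]
  split_ifs with ht
  · obtain ⟨s, hs, rfl⟩ : ∃ u, t ∉ u ∧ s = insert t u :=
      ⟨s.erase t, Finset.notMem_erase t s, (Finset.insert_erase ht).symm⟩
    unfold mul
    rw [Finset.sum_powerset_insert hs, Finset.sum_powerset_insert hs, ← Finset.sum_add_distrib,
      ← Finset.sum_add_distrib, ← Finset.sum_add_distrib]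
    symm
    refine Finset.sum_eq_zero fun A hA => ?_
    obtain ⟨hA', hB, e1, e2, e3⟩ := key s hs A hA
    simp only [e1, e2, pderiv_apply, hA', hB, Finset.mem_insert_self, if_true, if_false,
      msign_insert_left _ hA', msign_insert_right hA' hB, parity, Finset.card_insert_of_notMem hA',
      pow_succ]
    linear_combination ((-1) ^ A.card * msign A (s \ A) * f (insert t A) *
      g (insert t (s \ A))) * (lsign_mul_self (R := R) t A - lsign_mul_self (R := R) t (s \ A))
  · unfold mul
    rw [Finset.sum_powerset_insert ht, _root_.mul_add, Finset.mul_sum, Finset.mul_sum, add_comm]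
    congr 1 <;> refine Finset.sum_congr rfl fun A hA => ?_ <;>
      obtain ⟨hA', hB, e1, e2, e3⟩ := key s ht A hA
    · rw [e2, e3, msign_insert_left _ hA', pderiv_apply, if_neg hA']
      linear_combination (lsign t A * msign A (s \ A) * f (insert t A) * g (s \ A)) *
        lsign_mul_self (R := R) t (s \ A)
    · rw [e1, e3, msign_insert_right hA' hB, pderiv_apply, if_neg hB, parity]
      linear_combination ((-1) ^ A.card * lsign t (s \ A) * msign A (s \ A) * f A *
        g (insert t (s \ A))) * lsign_mul_self (R := R) t A

/-- `f` is concentrated in even degrees. -/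
def IsEven (f : Gr R N) : Prop := ∀ s, f s ≠ 0 → Even s.card

theorem IsEven.parity_eq {f : Gr R N} (hf : IsEven f) : parity f = f := by
  ext s
  by_cases h : f s = 0
  · simp [parity, h]
  · simp [parity, (hf s h).neg_one_pow]

theorem IsEven.mul_comm {f : Gr R N} (hf : IsEven f) (g : Gr R N) : mul f g = mul g f := by
  ext s
  unfold mul
  refine Finset.sum_bij' (fun A _ => s \ A) (fun A _ => s \ A) ?_ ?_ ?_ ?_ ?_
  · intro A _; simp
  · intro A _; simp
  · intro A hA; simpa using hA
  · intro A hA; simpa using hA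
  · intro A hA
    rw [Finset.mem_powerset] at hA
    by_cases h : f A = 0
    · simp [h, hA]
    · rw [msign_swap Finset.disjoint_sdiff, ((hf A h).mul_right _).neg_one_pow]
      simp only [sdiff_sdiff_right_self, Finset.inf_eq_inter, Finset.inter_eq_right.2 hA]
      ring

theorem IsEven.pderiv_mul {f : Gr R N} (hf : IsEven f) (t : Fin N) (g : Gr R N) :
    pderiv t (mul f g) = mul (pderiv t f) g + mul f (pderiv t g) := by
  rw [Gr.pderiv_mul, hf.parity_eq]

theorem IsEven.mul_left_comm {f : Gr R N} (hf : IsEven f) (g h : Gr R N) :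
    mul f (mul g h) = mul g (mul f h) := by
  rw [← mul_assoc, hf.mul_comm, mul_assoc]

theorem isEven_one : IsEven (one : Gr R N) := fun s hs => by
  by_cases h : s = ∅
  · simp [h]
  · exact absurd (by simp [one, h]) hs

theorem mul_one (f : Gr R N) : mul f one = f := by
  rw [← isEven_one.mul_comm, one_mul]

theorem parity_gen (t : Fin N) : parity (gen t : Gr R N) = -gen t := by
  ext s
  simp only [parity, gen, Pi.neg_apply]
  split_ifs with h
  · simp [h]
  · simp

theorem pderiv_gen (i t : Fin N) : pderiv i (gen t : Gr R N) = if i = t then one else 0 := by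
  ext s
  rw [pderiv_apply]
  by_cases h : i = t
  · subst h
    by_cases hs : s = ∅
    · simp [hs, one, gen, lsign]
    · simp only [if_true, one, hs, if_false, gen]
      split_ifs with h1 h2
      · rfl
      · exfalso
        apply hs
        refine Finset.eq_empty_of_forall_notMem fun x hx => ?_
        have : x ∈ ({i} : Finset _) := h2 ▸ Finset.mem_insert_of_mem hx
        rw [Finset.mem_singleton] at this
        exact h1 (this ▸ hx)
      · simp
  · have : insert i s ≠ {t} := fun e => h (by
      have : i ∈ ({t} : Finset _) := e ▸ Finset.mem_insert_self i s
      simpa using this)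
    simp [h, gen, this]

theorem pderiv_gen_mul (i t : Fin N) (f : Gr R N) :
    pderiv i (mul (gen t) f) = (if i = t then f else 0) - mul (gen t) (pderiv i f) := by
  rw [pderiv_mul, pderiv_gen, parity_gen, ← neg_one_smul R (gen t), smul_mul, neg_one_smul,
    sub_eq_add_neg]
  congr 1
  split_ifs
  · rw [one_mul]
  · exact mulL.map_zero₂ f

theorem pderiv_pderiv (i j : Fin N) (f : Gr R N) :
    pderiv i (pderiv j f) = -pderiv j (pderiv i f) := by
  ext s
  rw [Pi.neg_apply]
  simp only [pderiv_apply, Finset.mem_insert]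
  by_cases hij : i = j
  · subst hij; simp
  by_cases hi : i ∈ s
  · simp [hi]
  by_cases hj : j ∈ s
  · simp [hj]
  rw [if_neg hi, if_neg hj, if_neg (by tauto), if_neg (by tauto), lsign_insert _ hi,
    lsign_insert _ hj, Finset.insert_comm]
  rcases lt_or_gt_of_ne hij with h | h
  · simp only [h, h.not_gt, if_true, if_false]; ring
  · simp only [h, h.not_gt, if_true, if_false]; ring

theorem gen_mul_pderiv_apply (t : Fin N) (f : Gr R N) (s : Finset (Fin N)) :
    mul (gen t) (pderiv t f) s = if t ∈ s then f s else 0 := by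
  rw [gen_mul_apply]
  split_ifs with h
  · rw [pderiv_apply, if_neg (Finset.notMem_erase t s), lsign_erase_self, Finset.insert_erase h,
      ← _root_.mul_assoc, lsign_mul_self, _root_.one_mul]
  · rfl

/-- `f` is concentrated in degree `d`. -/
def IsDeg (f : Gr R N) (d : ℕ) : Prop := ∀ s, f s ≠ 0 → s.card = d

theorem IsDeg.mul {f g : Gr R N} {d e : ℕ} (hf : IsDeg f d) (hg : IsDeg g e) :
    IsDeg (mul f g) (d + e) := by
  intro s hs
  obtain ⟨A, hA, h⟩ := Finset.exists_ne_zero_of_sum_ne_zero hs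
  rw [← hf A (fun h0 => h (by simp [h0])), ← hg (s \ A) (fun h0 => h (by simp [h0])),
    add_comm, Finset.card_sdiff_add_card_eq_card (Finset.mem_powerset.1 hA)]

theorem isDeg_gen (t : Fin N) : IsDeg (gen t : Gr R N) 1 := by
  intro s hs
  by_cases h : s = {t}
  · simp [h]
  · exact absurd (by simp [gen, h]) hs

theorem isDeg_one : IsDeg (one : Gr R N) 0 := by
  intro s hs
  by_cases h : s = ∅
  · simp [h]
  · exact absurd (by simp [one, h]) hs

theorem IsDeg.smul {f : Gr R N} {d : ℕ} (hf : IsDeg f d) (c : R) : IsDeg (c • f) d :=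
  fun s hs => hf s fun h => hs (by simp [h])

theorem IsDeg.add {f g : Gr R N} {d : ℕ} (hf : IsDeg f d) (hg : IsDeg g d) : IsDeg (f + g) d := by
  intro s hs
  by_cases h : f s = 0
  · exact hg s fun h' => hs (by simp [h, h'])
  · exact hf s h

theorem IsDeg.sum {ι : Type} {I : Finset ι} {f : ι → Gr R N} {d : ℕ}
    (hf : ∀ i ∈ I, IsDeg (f i) d) : IsDeg (∑ i ∈ I, f i) d := by
  intro s hs
  rw [Finset.sum_apply] at hs
  obtain ⟨i, hi, h⟩ := Finset.exists_ne_zero_of_sum_ne_zero hs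
  exact hf i hi s h

theorem IsDeg.pow {f : Gr R N} {d : ℕ} (hf : IsDeg f d) (k : ℕ) : IsDeg (pow f k) (k * d) := by
  induction k with
  | zero => simpa [Gr.pow] using isDeg_one
  | succ k ih => rw [Nat.succ_mul]; exact ih.mul hf

theorem IsDeg.isEven {f : Gr R N} {d : ℕ} (hf : IsDeg f d) (hd : Even d) : IsEven f :=
  fun s hs => (hf s hs).symm ▸ hd

theorem IsDeg.eq_zero {f : Gr R N} {d : ℕ} (hf : IsDeg f d) (hd : N < d) : f = 0 := by
  ext s
  by_contra h
  have := hf s h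
  have := Finset.card_le_univ s
  simp at this
  omega

theorem pow_smul (c : R) (f : Gr R N) (k : ℕ) : pow (c • f) k = c ^ k • pow f k := by
  induction k with
  | zero => simp [Gr.pow]
  | succ k ih => rw [Gr.pow, Gr.pow, ih, smul_mul, mul_smul, smul_smul, ← pow_succ]

theorem pderiv_one (t : Fin N) : pderiv t (one : Gr R N) = 0 := by
  ext s; simp [pderiv_apply, one]

theorem pderiv_pow {f h : Gr R N} (hf : IsDeg f 2) {t : Fin N} (hd : pderiv t f = h) (k : ℕ) :
    pderiv t (pow f (k + 1)) = ((k + 1 : ℕ) : R) • mul h (pow f k) := by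
  have hev (k : ℕ) : IsEven (pow f k) := (hf.pow k).isEven (by simp)
  induction k with
  | zero => simp [Gr.pow, one_mul, mul_one, hd]
  | succ k ih =>
    rw [Gr.pow, (hev _).pderiv_mul, ih, hd, (hev _).mul_comm, smul_mul, mul_assoc, ← Gr.pow,
      Nat.cast_succ (k + 1), add_smul, one_smul]

end Algebra

section Exponential

variable {N : ℕ}

/-- The exponential series truncated after degree `K`. -/
def truncExp (K : ℕ) (f : Gr ℂ N) : Gr ℂ N :=
  ∑ k ∈ Finset.range (K + 1), ((k.factorial : ℂ))⁻¹ • pow f k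

theorem isEven_truncExp (K : ℕ) {f : Gr ℂ N} (hf : IsDeg f 2) : IsEven (truncExp K f) := by
  intro s hs
  rw [truncExp, Finset.sum_apply] at hs
  obtain ⟨k, -, hk⟩ := Finset.exists_ne_zero_of_sum_ne_zero hs
  exact ((hf.pow k).smul _).isEven (by simp) s hk

theorem truncExp_empty (K : ℕ) {f : Gr ℂ N} (hf : IsDeg f 2) : truncExp K f ∅ = 1 := by
  rw [truncExp, Finset.sum_apply, Finset.sum_eq_single 0]
  · simp [pow, one]
  · intro k _ hk
    by_contra h
    have := ((hf.pow k).smul _) ∅ h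
    simp at this
    omega
  · simp

theorem pderiv_truncExp {K : ℕ} (hK : N < 2 * K + 1) {f h : Gr ℂ N} (hf : IsDeg f 2)
    (hh : IsDeg h 1) {t : Fin N} (hd : pderiv t f = h) :
    pderiv t (truncExp K f) = mul h (truncExp K f) := by
  have hlast : mul h (pow f K) = 0 := (hh.mul (hf.pow K)).eq_zero (by omega)
  rw [truncExp, pderiv_sum, Finset.sum_range_succ', mul_sum, Finset.sum_range_succ, mul_smul, hlast]
  simp only [pderiv_smul, mul_smul, pderiv_pow hf hd, show pow f 0 = one from rfl, pderiv_one,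
    smul_zero, add_zero]
  refine Finset.sum_congr rfl fun k _ => ?_
  rw [smul_smul, Nat.factorial_succ]
  congr 1
  have : (k.factorial : ℂ) ≠ 0 := Nat.cast_ne_zero.2 k.factorial_ne_zero
  have : ((k + 1 : ℕ) : ℂ) ≠ 0 := Nat.cast_ne_zero.2 k.succ_ne_zero
  push_cast at *
  field_simp

end Exponential

end Gr


section FermionicFourier

variable {n : ℕ}

theorem lo_inj {i j : Fin n} : lo n i = lo n j ↔ i = j := by
  simp only [lo, Fin.ext_iff]; omega

theorem hi_inj {i j : Fin n} : hi n i = hi n j ↔ i = j := by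
  simp only [hi, Fin.ext_iff]; omega

theorem lo_ne_hi (i j : Fin n) : lo n i ≠ hi n j := by
  simp only [lo, hi, ne_eq, Fin.ext_iff]; omega

theorem hi_ne_lo (i j : Fin n) : hi n i ≠ lo n j := (lo_ne_hi j i).symm

theorem xi_inj {s t : Fin (2 * n)} : xi n s = xi n t ↔ s = t := by
  simp only [xi, Fin.ext_iff, Fin.val_castAdd]

theorem yi_inj {s t : Fin (2 * n)} : yi n s = yi n t ↔ s = t := by
  simp only [yi, Fin.ext_iff, Fin.val_natAdd]; omega

theorem xi_ne_yi (s t : Fin (2 * n)) : xi n s ≠ yi n t := by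
  simp only [xi, yi, ne_eq, Fin.ext_iff, Fin.val_natAdd, Fin.val_castAdd]; omega

theorem yi_ne_xi (s t : Fin (2 * n)) : yi n s ≠ xi n t := (xi_ne_yi t s).symm

theorem eq_lo_or_eq_hi (t : Fin (2 * n)) : (∃ j, t = lo n j) ∨ ∃ j, t = hi n j := by
  rcases Nat.even_or_odd' (t : ℕ) with ⟨c, h | h⟩
  · exact Or.inl ⟨⟨c, by omega⟩, Fin.ext h⟩
  · exact Or.inr ⟨⟨c, by omega⟩, Fin.ext h⟩

theorem disjoint_lo_hi (I J : Finset (Fin n)) : Disjoint (I.image (lo n)) (J.image (hi n)) := by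
  rw [Finset.disjoint_left]
  intro t h1 h2
  obtain ⟨i, -, rfl⟩ := Finset.mem_image.1 h1
  obtain ⟨j, -, h⟩ := Finset.mem_image.1 h2
  exact hi_ne_lo j i h

theorem univ_eq_lo_union_hi :
    (univ : Finset (Fin (2 * n))) = univ.image (lo n) ∪ univ.image (hi n) := by
  ext t
  rcases eq_lo_or_eq_hi t with ⟨j, rfl⟩ | ⟨j, rfl⟩ <;> simp

theorem sum_lo_hi {α : Type} [AddCommMonoid α] (f : Fin (2 * n) → α) :
    ∑ t, f t = ∑ j, (f (lo n j) + f (hi n j)) := by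
  rw [univ_eq_lo_union_hi, Finset.sum_union (disjoint_lo_hi _ _),
    Finset.sum_image fun _ _ _ _ h => lo_inj.1 h, Finset.sum_image fun _ _ _ _ h => hi_inj.1 h,
    Finset.sum_add_distrib]

theorem lsign_xi (t : Fin (2 * n)) (A : Finset (Fin (2 * n))) :
    (Gr.lsign (xi n t) (A.image (xi n)) : ℂ) = Gr.lsign t A := by
  unfold Gr.lsign
  rw [Finset.prod_image fun _ _ _ _ h => xi_inj.1 h]
  simp only [xi, Fin.lt_def, Fin.val_castAdd]

theorem lsign_yi (t : Fin (2 * n)) (A : Finset (Fin (2 * n))) :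
    (Gr.lsign (yi n t) (A.image (yi n)) : ℂ) = Gr.lsign t A := by
  unfold Gr.lsign
  rw [Finset.prod_image fun _ _ _ _ h => yi_inj.1 h]
  simp only [yi, Fin.lt_def, Fin.val_natAdd, add_lt_add_iff_left]

theorem xi_mem_image {t : Fin (2 * n)} {A : Finset (Fin (2 * n))} :
    xi n t ∈ A.image (xi n) ↔ t ∈ A := by
  simp [xi_inj]

theorem yi_mem_image {t : Fin (2 * n)} {A : Finset (Fin (2 * n))} :
    yi n t ∈ A.image (yi n) ↔ t ∈ A := by
  simp [yi_inj]

theorem embX_image (f : Gr ℂ (2 * n)) (A : Finset (Fin (2 * n))) :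
    embX n f (A.image (xi n)) = f A := by
  have h (B : Finset (Fin (2 * n))) : A.image (xi n) = B.image (xi n) ↔ A = B :=
    (Finset.image_injective fun _ _ h => xi_inj.1 h).eq_iff
  simp [embX, h]

theorem embX_of_forall_ne (f : Gr ℂ (2 * n)) {s : Finset (Fin (2 * n + 2 * n))}
    (h : ∀ A : Finset (Fin (2 * n)), s ≠ A.image (xi n)) : embX n f s = 0 := by
  simp [embX, h]

theorem embX_gen_mul (t : Fin (2 * n)) (f : Gr ℂ (2 * n)) :
    embX n (Gr.mul (Gr.gen t) f) = Gr.mul (Gr.gen (xi n t)) (embX n f) := by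
  ext s
  rw [Gr.gen_mul_apply]
  by_cases h : ∃ A : Finset (Fin (2 * n)), s = A.image (xi n)
  · obtain ⟨A, rfl⟩ := h
    rw [embX_image, Gr.gen_mul_apply, lsign_xi, ← Finset.image_erase fun _ _ h => xi_inj.1 h,
      embX_image]
    simp only [xi_mem_image]
  · push Not at h
    rw [embX_of_forall_ne _ h]
    split_ifs with ht
    · rw [embX_of_forall_ne, mul_zero]
      intro A hA
      apply h (insert t A)
      rw [Finset.image_insert, ← hA, Finset.insert_erase ht]
    · rfl

theorem embX_pderiv (t : Fin (2 * n)) (f : Gr ℂ (2 * n)) :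
    embX n (Gr.pderiv t f) = Gr.pderiv (xi n t) (embX n f) := by
  ext s
  rw [Gr.pderiv_apply]
  by_cases h : ∃ A : Finset (Fin (2 * n)), s = A.image (xi n)
  · obtain ⟨A, rfl⟩ := h
    rw [embX_image, Gr.pderiv_apply, lsign_xi, ← Finset.image_insert, embX_image]
    simp only [xi_mem_image]
  · push Not at h
    rw [embX_of_forall_ne _ h]
    split_ifs with ht
    · rfl
    · rw [embX_of_forall_ne, mul_zero]
      intro A hA
      apply h (A.erase t)
      rw [Finset.image_erase fun _ _ h => xi_inj.1 h, ← hA, Finset.erase_insert ht]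

theorem pderiv_yi_embX (t : Fin (2 * n)) (f : Gr ℂ (2 * n)) :
    Gr.pderiv (yi n t) (embX n f) = 0 := by
  ext s
  rw [Gr.pderiv_apply]
  split_ifs
  · rfl
  · rw [embX_of_forall_ne, mul_zero, Pi.zero_apply]
    intro A hA
    have : yi n t ∈ A.image (xi n) := hA ▸ Finset.mem_insert_self _ _
    obtain ⟨u, -, hu⟩ := Finset.mem_image.1 this
    exact xi_ne_yi _ _ hu

/-- The part of an element of `Λ_{4n}` that only involves the `y` generators. -/
def restrictY (n : ℕ) (G : Gr ℂ (2 * n + 2 * n)) : Gr ℂ (2 * n) := fun s => G (s.image (yi n))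

theorem restrictY_gen_mul (t : Fin (2 * n)) (G : Gr ℂ (2 * n + 2 * n)) :
    restrictY n (Gr.mul (Gr.gen (yi n t)) G) = Gr.mul (Gr.gen t) (restrictY n G) := by
  ext s
  simp only [restrictY, Gr.gen_mul_apply, yi_mem_image, lsign_yi,
    Finset.image_erase fun _ _ h => yi_inj.1 h]

theorem restrictY_pderiv (t : Fin (2 * n)) (G : Gr ℂ (2 * n + 2 * n)) :
    restrictY n (Gr.pderiv (yi n t) G) = Gr.pderiv t (restrictY n G) := by
  ext s
  simp only [restrictY, Gr.pderiv_apply, yi_mem_image, lsign_yi, Finset.image_insert]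

namespace Gr

variable {R : Type} [CommRing R] {N : ℕ}

/-- Iterated left partial derivatives as a linear map. -/
def derivListL (l : List (Fin N)) : Gr R N →ₗ[R] Gr R N where
  toFun := derivList l
  map_add' f g := by
    induction l generalizing f g with
    | nil => rfl
    | cons a l ih =>
      change derivList l (pderiv a (f + g)) = _
      rw [pderiv_add]; exact ih _ _
  map_smul' c f := by
    induction l generalizing f with
    | nil => rfl
    | cons a l ih =>
      change derivList l (pderiv a (c • f)) = _
      rw [pderiv_smul]; exact ih _

theorem derivListL_apply (l : List (Fin N)) (f : Gr R N) : derivListL l f = derivList l f := rfl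

theorem derivList_cons (a : Fin N) (l : List (Fin N)) (f : Gr R N) :
    derivList (a :: l) f = derivList l (pderiv a f) := rfl

theorem derivList_neg (l : List (Fin N)) (f : Gr R N) : derivList l (-f) = -derivList l f :=
  map_neg (derivListL l) f

theorem derivList_pderiv (l : List (Fin N)) (i : Fin N) (f : Gr R N) :
    derivList l (pderiv i f) = (-1 : R) ^ l.length • pderiv i (derivList l f) := by
  induction l generalizing f with
  | nil => simp [derivList]
  | cons a l ih =>
    rw [derivList_cons, derivList_cons, pderiv_pderiv, derivList_neg, ih, List.length_cons,
      pow_succ, mul_neg_one, neg_smul]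

theorem derivList_gen_mul (l : List (Fin N)) {u : Fin N} (hu : u ∉ l) (f : Gr R N) :
    derivList l (mul (gen u) f) = (-1 : R) ^ l.length • mul (gen u) (derivList l f) := by
  induction l generalizing f with
  | nil => simp [derivList]
  | cons a l ih =>
    rw [List.mem_cons, not_or] at hu
    rw [derivList_cons, derivList_cons, pderiv_gen_mul, if_neg (Ne.symm hu.1), zero_sub,
      derivList_neg, ih hu.2, List.length_cons, pow_succ, mul_neg_one, neg_smul]

theorem derivList_pderiv_of_mem {l : List (Fin N)} {i : Fin N} (hi : i ∈ l) (f : Gr R N) :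
    derivList l (pderiv i f) = 0 := by
  induction l generalizing f with
  | nil => simp at hi
  | cons a l ih =>
    rw [derivList_cons]
    by_cases h : i = a
    · subst h
      have : pderiv i (pderiv i f) = 0 := by ext s; simp [pderiv_apply]
      rw [this]; exact map_zero (derivListL l)
    · rw [pderiv_pderiv, derivList_neg, ih ((List.mem_cons.1 hi).resolve_left h), neg_zero]

theorem derivList_empty_of_sorted {l : List (Fin N)} (hl : l.Pairwise (· < ·)) (f : Gr R N) :
    derivList l f ∅ = f l.toFinset := by
  induction l generalizing f with
  | nil => rfl
  | cons a l ih =>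
    rw [List.pairwise_cons] at hl
    rw [derivList_cons, ih hl.2, pderiv_apply, if_neg, List.toFinset_cons, lsign,
      Finset.prod_eq_one, _root_.one_mul]
    · intro b hb
      rw [if_neg (hl.1 b (List.mem_toFinset.1 hb)).not_gt]
    · intro h
      exact lt_irrefl _ (hl.1 a (List.mem_toFinset.1 h))

theorem pderiv_sub (t : Fin N) (f g : Gr R N) : pderiv t (f - g) = pderiv t f - pderiv t g :=
  map_sub (pderivL t) f g

theorem mul_sub (f g h : Gr R N) : mul f (g - h) = mul f g - mul f h := map_sub (mulL f) g h

theorem mul_zero (f : Gr R N) : mul f 0 = 0 := map_zero (mulL f)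

end Gr

/-- The exponent of the fermionic Fourier kernel. -/
def kernelArg (n : ℕ) (σ : ℂ) : Gr ℂ (2 * n + 2 * n) :=
  (-σ * (Complex.I / 2)) • ∑ j : Fin n,
    (Gr.mul (Gr.gen (xi n (lo n j))) (Gr.gen (yi n (hi n j))) -
     Gr.mul (Gr.gen (xi n (hi n j))) (Gr.gen (yi n (lo n j))))

theorem fermK_eq (σ : ℂ) : fermK n σ = Gr.truncExp (2 * n + 2 * n) (kernelArg n σ) := rfl

theorem isDeg_kernelArg (σ : ℂ) : Gr.IsDeg (kernelArg n σ) 2 := by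
  refine Gr.IsDeg.smul (Gr.IsDeg.sum fun j _ => ?_) _
  rw [sub_eq_add_neg, ← neg_one_smul ℂ]
  exact ((Gr.isDeg_gen _).mul (Gr.isDeg_gen _)).add
    (((Gr.isDeg_gen _).mul (Gr.isDeg_gen _)).smul _)

theorem isEven_fermK (σ : ℂ) : Gr.IsEven (fermK n σ) :=
  Gr.isEven_truncExp _ (isDeg_kernelArg σ)

theorem pderiv_fermK {σ c : ℂ} {t u : Fin (2 * n + 2 * n)}
    (h : Gr.pderiv t (kernelArg n σ) = c • Gr.gen u) :
    Gr.pderiv t (fermK n σ) = c • Gr.mul (Gr.gen u) (fermK n σ) := by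
  rw [fermK_eq, Gr.pderiv_truncExp (by omega) (isDeg_kernelArg σ) ((Gr.isDeg_gen u).smul c) h,
    Gr.smul_mul]

theorem gen_mul_ite_one {N : ℕ} {R : Type} [CommRing R] (f : Gr R N) (p : Prop) [Decidable p] :
    Gr.mul f (if p then Gr.one else 0) = if p then f else 0 := by
  split_ifs
  · exact Gr.mul_one f
  · exact Gr.mul_zero f

theorem pderiv_yi_hi_kernelArg (σ : ℂ) (j : Fin n) :
    Gr.pderiv (yi n (hi n j)) (kernelArg n σ) = (σ * (Complex.I / 2)) • Gr.gen (xi n (lo n j)) := by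
  rw [kernelArg, Gr.pderiv_smul, Gr.pderiv_sum]
  simp [Gr.pderiv_sub, Gr.pderiv_gen_mul,
    Gr.pderiv_gen, yi_inj, hi_inj, yi_ne_xi, hi_ne_lo,
    gen_mul_ite_one, Gr.mul_zero]

theorem pderiv_yi_lo_kernelArg (σ : ℂ) (j : Fin n) :
    Gr.pderiv (yi n (lo n j)) (kernelArg n σ) =
      (-σ * (Complex.I / 2)) • Gr.gen (xi n (hi n j)) := by
  rw [kernelArg, Gr.pderiv_smul, Gr.pderiv_sum]
  simp [Gr.pderiv_sub, Gr.pderiv_gen_mul,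
    Gr.pderiv_gen, yi_inj, lo_inj, yi_ne_xi, lo_ne_hi,
    gen_mul_ite_one, Gr.mul_zero]

theorem pderiv_xi_hi_kernelArg (σ : ℂ) (j : Fin n) :
    Gr.pderiv (xi n (hi n j)) (kernelArg n σ) = (σ * (Complex.I / 2)) • Gr.gen (yi n (lo n j)) := by
  rw [kernelArg, Gr.pderiv_smul, Gr.pderiv_sum]
  simp [Gr.pderiv_sub, Gr.pderiv_gen_mul,
    Gr.pderiv_gen, xi_inj, hi_inj, xi_ne_yi, hi_ne_lo,
    Gr.mul_zero]

theorem pderiv_xi_lo_kernelArg (σ : ℂ) (j : Fin n) :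
    Gr.pderiv (xi n (lo n j)) (kernelArg n σ) =
      (-σ * (Complex.I / 2)) • Gr.gen (yi n (hi n j)) := by
  rw [kernelArg, Gr.pderiv_smul, Gr.pderiv_sum]
  simp [Gr.pderiv_sub, Gr.pderiv_gen_mul,
    Gr.pderiv_gen, xi_inj, lo_inj, xi_ne_yi, lo_ne_hi,
    Gr.mul_zero]

/-- The fermionic Fourier transform without its normalising factor `(2π)^n`. -/
def kernelMap (n : ℕ) (σ : ℂ) : Gr ℂ (2 * n) →ₗ[ℂ] Gr ℂ (2 * n) where
  toFun g := restrictY n (berezinX n (Gr.mul (fermK n σ) (embX n g)))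
  map_add' f g := by
    have h : embX n (f + g) = embX n f + embX n g := by
      ext s; simp only [embX, Pi.add_apply, ← Finset.sum_add_distrib]
      exact Finset.sum_congr rfl fun _ _ => by split_ifs <;> simp
    simp only [berezinX, ← Gr.derivListL_apply, h, Gr.mul_add, map_add, smul_add]
    rfl
  map_smul' c f := by
    have h : embX n (c • f) = c • embX n f := by
      ext s; simp only [embX, Pi.smul_apply, Finset.smul_sum]
      exact Finset.sum_congr rfl fun _ _ => by split_ifs <;> simp
    simp only [berezinX, ← Gr.derivListL_apply, h, Gr.mul_smul, map_smul,
      smul_comm _ c, RingHom.id_apply]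
    rfl

theorem kernelMap_apply (σ : ℂ) (g : Gr ℂ (2 * n)) (s : Finset (Fin (2 * n))) :
    kernelMap n σ g s = berezinX n (Gr.mul (fermK n σ) (embX n g)) (s.image (yi n)) := rfl

theorem berezinX_smul (c : ℂ) (G : Gr ℂ (2 * n + 2 * n)) :
    berezinX n (c • G) = c • berezinX n G := by
  simp only [berezinX, ← Gr.derivListL_apply, map_smul, smul_comm _ c]

theorem berezinX_add (F G : Gr ℂ (2 * n + 2 * n)) :
    berezinX n (F + G) = berezinX n F + berezinX n G := by
  simp only [berezinX, ← Gr.derivListL_apply, map_add, smul_add]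

theorem neg_one_pow_length :
    (-1 : ℂ) ^ ((List.finRange (2 * n)).map (xi n)).length = 1 := by simp

theorem berezinX_pderiv_yi (t : Fin (2 * n)) (G : Gr ℂ (2 * n + 2 * n)) :
    berezinX n (Gr.pderiv (yi n t) G) = Gr.pderiv (yi n t) (berezinX n G) := by
  rw [berezinX, Gr.derivList_pderiv, neg_one_pow_length, one_smul, berezinX, Gr.pderiv_smul]

theorem berezinX_gen_yi_mul (t : Fin (2 * n)) (G : Gr ℂ (2 * n + 2 * n)) :
    berezinX n (Gr.mul (Gr.gen (yi n t)) G) = Gr.mul (Gr.gen (yi n t)) (berezinX n G) := by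
  rw [berezinX, Gr.derivList_gen_mul, neg_one_pow_length, one_smul, berezinX, Gr.mul_smul]
  simp [xi_ne_yi]

theorem berezinX_pderiv_xi (t : Fin (2 * n)) (G : Gr ℂ (2 * n + 2 * n)) :
    berezinX n (Gr.pderiv (xi n t) G) = 0 := by
  rw [berezinX, Gr.derivList_pderiv_of_mem, smul_zero]
  simp [xi_inj]

theorem kernelMap_eq (σ : ℂ) (g : Gr ℂ (2 * n)) :
    kernelMap n σ g = restrictY n (berezinX n (Gr.mul (fermK n σ) (embX n g))) := rfl

theorem pderiv_kernelMap {σ c : ℂ} {t u : Fin (2 * n)}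
    (h : Gr.pderiv (yi n t) (kernelArg n σ) = c • Gr.gen (xi n u)) (g : Gr ℂ (2 * n)) :
    Gr.pderiv t (kernelMap n σ g) = c • kernelMap n σ (Gr.mul (Gr.gen u) g) := by
  change Gr.pderiv t (restrictY n _) = c • restrictY n _
  rw [← restrictY_pderiv, ← berezinX_pderiv_yi, (isEven_fermK σ).pderiv_mul, pderiv_yi_embX,
    Gr.mul_zero, add_zero, pderiv_fermK h, Gr.smul_mul, berezinX_smul, embX_gen_mul,
    (isEven_fermK σ).mul_left_comm, Gr.mul_assoc]
  rfl

theorem kernelMap_pderiv {σ c : ℂ} {t u : Fin (2 * n)}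
    (h : Gr.pderiv (xi n t) (kernelArg n σ) = c • Gr.gen (yi n u)) (g : Gr ℂ (2 * n)) :
    kernelMap n σ (Gr.pderiv t g) = -c • Gr.mul (Gr.gen u) (kernelMap n σ g) := by
  have key := berezinX_pderiv_xi t (Gr.mul (fermK n σ) (embX n g))
  rw [(isEven_fermK σ).pderiv_mul, pderiv_fermK h, Gr.smul_mul, berezinX_add, berezinX_smul,
    Gr.mul_assoc, berezinX_gen_yi_mul, ← embX_pderiv] at key
  rw [kernelMap_eq, kernelMap_eq, eq_neg_of_add_eq_zero_right key, ← restrictY_gen_mul, neg_smul]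
  rfl

theorem kernelMap_pderiv_lo (σ : ℂ) (j : Fin n) (g : Gr ℂ (2 * n)) :
    kernelMap n σ (Gr.pderiv (lo n j) g) =
      (σ * Complex.I / 2) • Gr.mul (Gr.gen (hi n j)) (kernelMap n σ g) := by
  rw [kernelMap_pderiv (pderiv_xi_lo_kernelArg σ j)]; congr 1; ring

theorem kernelMap_pderiv_hi (σ : ℂ) (j : Fin n) (g : Gr ℂ (2 * n)) :
    kernelMap n σ (Gr.pderiv (hi n j) g) =
      (-(σ * Complex.I / 2)) • Gr.mul (Gr.gen (lo n j)) (kernelMap n σ g) := by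
  rw [kernelMap_pderiv (pderiv_xi_hi_kernelArg σ j)]; congr 1; ring

theorem kernelMap_gen_lo {σ : ℂ} (hσ : σ ^ 2 = 1) (j : Fin n) (g : Gr ℂ (2 * n)) :
    kernelMap n σ (Gr.mul (Gr.gen (lo n j)) g) =
      (-(2 * (σ * Complex.I))) • Gr.pderiv (hi n j) (kernelMap n σ g) := by
  rw [pderiv_kernelMap (pderiv_yi_hi_kernelArg σ j), smul_smul]
  rw [show -(2 * (σ * Complex.I)) * (σ * (Complex.I / 2)) = 1 by
    linear_combination (-σ ^ 2) * Complex.I_sq + hσ, one_smul]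

theorem kernelMap_gen_hi {σ : ℂ} (hσ : σ ^ 2 = 1) (j : Fin n) (g : Gr ℂ (2 * n)) :
    kernelMap n σ (Gr.mul (Gr.gen (hi n j)) g) =
      (2 * (σ * Complex.I)) • Gr.pderiv (lo n j) (kernelMap n σ g) := by
  rw [pderiv_kernelMap (pderiv_yi_lo_kernelArg σ j), smul_smul]
  rw [show 2 * (σ * Complex.I) * (-σ * (Complex.I / 2)) = 1 by
    linear_combination (-σ ^ 2) * Complex.I_sq + hσ, one_smul]

theorem isDeg_xsq : Gr.IsDeg (xsq n) 2 :=
  Gr.IsDeg.sum fun _ _ => (Gr.isDeg_gen _).mul (Gr.isDeg_gen _)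

theorem fermGauss_eq : fermGauss n = Gr.truncExp n ((1 / 2 : ℂ) • xsq n) := by
  refine Finset.sum_congr rfl fun k _ => ?_
  rw [Gr.pow_smul, smul_smul]
  congr 1
  rw [mul_inv, one_div, inv_pow, mul_comm]

theorem isEven_fermGauss : Gr.IsEven (fermGauss n) := by
  rw [fermGauss_eq]; exact Gr.isEven_truncExp _ (isDeg_xsq.smul _)

theorem fermGauss_empty : fermGauss n ∅ = 1 := by
  rw [fermGauss_eq]; exact Gr.truncExp_empty _ (isDeg_xsq.smul _)

theorem pderiv_lo_fermGauss (j : Fin n) :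
    Gr.pderiv (lo n j) (fermGauss n) =
      (1 / 2 : ℂ) • Gr.mul (Gr.gen (hi n j)) (fermGauss n) := by
  rw [fermGauss_eq, Gr.pderiv_truncExp (h := (1 / 2 : ℂ) • Gr.gen (hi n j)) (by omega)
    (isDeg_xsq.smul _) ((Gr.isDeg_gen _).smul _), Gr.smul_mul]
  simp [xsq, Gr.pderiv_smul, Gr.pderiv_sum, Gr.pderiv_gen_mul, Gr.pderiv_gen, lo_inj, lo_ne_hi,
    Gr.mul_zero]

theorem pderiv_hi_fermGauss (j : Fin n) :
    Gr.pderiv (hi n j) (fermGauss n) =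
      (-(1 / 2) : ℂ) • Gr.mul (Gr.gen (lo n j)) (fermGauss n) := by
  rw [fermGauss_eq, Gr.pderiv_truncExp (h := (-(1 / 2) : ℂ) • Gr.gen (lo n j)) (by omega)
    (isDeg_xsq.smul _) ((Gr.isDeg_gen _).smul _), Gr.smul_mul]
  simp [xsq, Gr.pderiv_smul, Gr.pderiv_sum, Gr.pderiv_gen_mul, Gr.pderiv_gen, hi_inj, hi_ne_lo,
    gen_mul_ite_one]

theorem eq_zero_of_pderiv_eq {G : Gr ℂ (2 * n)} (h0 : G ∅ = 0)
    (hlo : ∀ j, Gr.pderiv (lo n j) G = (1 / 2 : ℂ) • Gr.mul (Gr.gen (hi n j)) G)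
    (hhi : ∀ j, Gr.pderiv (hi n j) G = (-(1 / 2) : ℂ) • Gr.mul (Gr.gen (lo n j)) G) : G = 0 := by
  have step (s : Finset (Fin (2 * n))) (ih : ∀ u, u ⊂ s → G u = 0) {t u : Fin (2 * n)} {c : ℂ}
      (ht : t ∈ s) (h : Gr.pderiv t G = c • Gr.mul (Gr.gen u) G) : G s = 0 := by
    have h1 := congrFun h (s.erase t)
    rw [Gr.pderiv_apply, if_neg (Finset.notMem_erase t s), Finset.insert_erase ht, Pi.smul_apply,
      Gr.gen_mul_apply, ih _ ((Finset.erase_subset _ _).trans_ssubset (Finset.erase_ssubset ht)),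
      mul_zero, ite_self, smul_zero] at h1
    have h2 := congrArg (fun z => (Gr.lsign t (s.erase t) : ℂ) * z) h1
    simpa [← mul_assoc, Gr.lsign_mul_self] using h2
  ext s
  induction s using Finset.strongInduction with
  | H s ih =>
    rcases s.eq_empty_or_nonempty with rfl | ⟨t, ht⟩
    · exact h0
    · rcases eq_lo_or_eq_hi t with ⟨j, rfl⟩ | ⟨j, rfl⟩
      · exact step s ih ht (hlo j)
      · exact step s ih ht (hhi j)

theorem fermGauss_lo_hi (J : Finset (Fin n)) :
    fermGauss n (J.image (lo n) ∪ J.image (hi n)) = (1 / 2 : ℂ) ^ J.card := by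
  induction J using Finset.induction_on with
  | empty => simpa using fermGauss_empty
  | insert j J hj ih =>
    set S := J.image (lo n) ∪ J.image (hi n) with hS
    have hlo : lo n j ∉ S := by simp [hS, lo_inj, hj, hi_ne_lo]
    have hhi : hi n j ∉ S := by simp [hS, hi_inj, hj, lo_ne_hi]
    have hset : (insert j J).image (lo n) ∪ (insert j J).image (hi n) =
        insert (lo n j) (insert (hi n j) S) := by
      rw [Finset.image_insert, Finset.image_insert, Finset.insert_union, Finset.union_insert]
    have hsign : (Gr.lsign (lo n j) S : ℂ) = Gr.lsign (hi n j) S := by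
      refine Finset.prod_congr rfl fun b hb => ?_
      have hb1 : (b : ℕ) ≠ 2 * j := fun e => hlo (by rwa [show lo n j = b from Fin.ext e.symm])
      have : b < lo n j ↔ b < hi n j := by
        simp only [lo, hi, Fin.lt_def]; omega
      simp only [this]
    have h := congrFun (pderiv_lo_fermGauss j) (insert (hi n j) S)
    have hlt : ¬ hi n j < lo n j := by simp [lo, hi, Fin.lt_def]
    rw [Gr.pderiv_apply, if_neg (by simp [hlo, lo_ne_hi]), Gr.lsign_insert _ hhi, if_neg hlt,
      Pi.smul_apply, Gr.gen_mul_apply, if_pos (Finset.mem_insert_self _ _),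
      Gr.lsign_insert _ hhi, if_neg (lt_irrefl _), Finset.erase_insert hhi, ih, hsign,
      smul_eq_mul] at h
    rw [hset, Finset.card_insert_of_notMem hj, pow_succ]
    linear_combination (Gr.lsign (hi n j) S : ℂ) * h +
      ((1 / 2 : ℂ) ^ J.card * (1 / 2) - fermGauss n (insert (lo n j) (insert (hi n j) S))) *
        Gr.lsign_mul_self (R := ℂ) (hi n j) S

theorem fermGauss_univ : fermGauss n univ = (1 / 2 : ℂ) ^ n := by
  rw [univ_eq_lo_union_hi, fermGauss_lo_hi]; simp

theorem fermK_eq_zero_of_subset (σ : ℂ) {A : Finset (Fin (2 * n))} (hA : A.Nonempty) :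
    fermK n σ (A.image (xi n)) = 0 := by
  have step {t u : Fin (2 * n)} {c : ℂ} (ht : t ∈ A)
      (h : Gr.pderiv (xi n t) (kernelArg n σ) = c • Gr.gen (yi n u)) :
      fermK n σ (A.image (xi n)) = 0 := by
    have h1 := congrFun (pderiv_fermK h) ((A.erase t).image (xi n))
    rw [Gr.pderiv_apply, if_neg (by simp [xi_inj]), ← Finset.image_insert,
      Finset.insert_erase ht, Pi.smul_apply, Gr.gen_mul_apply, if_neg (by simp [xi_ne_yi]),
      smul_zero, lsign_xi] at h1
    have h2 := congrArg (fun z => (Gr.lsign t (A.erase t) : ℂ) * z) h1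
    simpa [← mul_assoc, Gr.lsign_mul_self] using h2
  obtain ⟨t, ht⟩ := hA
  rcases eq_lo_or_eq_hi t with ⟨j, rfl⟩ | ⟨j, rfl⟩
  · exact step ht (pderiv_xi_lo_kernelArg σ j)
  · exact step ht (pderiv_xi_hi_kernelArg σ j)

theorem kernelMap_fermGauss_empty (σ : ℂ) :
    kernelMap n σ (fermGauss n) ∅ = ((2 * Real.pi : ℂ) ^ n)⁻¹ := by
  have hsort : ((List.finRange (2 * n)).map (xi n)).Pairwise (· < ·) := by
    rw [List.pairwise_map]
    exact (List.pairwise_lt_finRange _).imp fun h => by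
      simpa only [xi, Fin.lt_def, Fin.val_castAdd] using h
  have hset : ((List.finRange (2 * n)).map (xi n)).toFinset = univ.image (xi n) := by
    ext t; simp
  rw [kernelMap_apply, Finset.image_empty, berezinX, Pi.smul_apply,
    Gr.derivList_empty_of_sorted hsort, hset, Gr.mul, Finset.sum_eq_single ∅]
  · rw [Finset.sdiff_empty, embX_image, fermGauss_univ, Gr.msign_empty_left, fermK_eq,
      Gr.truncExp_empty _ (isDeg_kernelArg σ)]
    rw [one_mul, one_mul, smul_eq_mul, mul_pow, mul_inv, one_div, inv_pow, mul_comm]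
  · intro B hB hne
    obtain ⟨A, -, rfl⟩ := Finset.subset_image_iff.1 (Finset.mem_powerset.1 hB)
    rw [fermK_eq_zero_of_subset, mul_zero, zero_mul]
    rw [Finset.nonempty_iff_ne_empty]
    rintro rfl
    exact hne (by simp)
  · simp

theorem kernelMap_fermGauss {σ : ℂ} (hσ : σ ^ 2 = 1) :
    kernelMap n σ (fermGauss n) = ((2 * Real.pi : ℂ) ^ n)⁻¹ • fermGauss n := by
  have hne : σ * Complex.I ≠ 0 :=
    mul_ne_zero (fun h => by simp [h] at hσ) Complex.I_ne_zero
  rw [← sub_eq_zero]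
  refine eq_zero_of_pderiv_eq ?_ (fun j => ?_) fun j => ?_
  · simp [kernelMap_fermGauss_empty, fermGauss_empty]
  · have h := kernelMap_pderiv_lo σ j (fermGauss n)
    rw [pderiv_lo_fermGauss, map_smul, kernelMap_gen_hi hσ, smul_smul] at h
    have h' : Gr.pderiv (lo n j) (kernelMap n σ (fermGauss n)) =
        (1 / 2 : ℂ) • Gr.mul (Gr.gen (hi n j)) (kernelMap n σ (fermGauss n)) := by
      refine smul_right_injective _ hne ?_
      dsimp only
      rw [smul_smul]
      convert h using 2 <;> ring
    rw [Gr.pderiv_sub, h', Gr.pderiv_smul, pderiv_lo_fermGauss, Gr.mul_sub, Gr.mul_smul, smul_sub,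
      smul_comm (1 / 2 : ℂ)]
  · have h := kernelMap_pderiv_hi σ j (fermGauss n)
    rw [pderiv_hi_fermGauss, map_smul, kernelMap_gen_lo hσ, smul_smul] at h
    have h' : Gr.pderiv (hi n j) (kernelMap n σ (fermGauss n)) =
        (-(1 / 2) : ℂ) • Gr.mul (Gr.gen (lo n j)) (kernelMap n σ (fermGauss n)) := by
      refine smul_right_injective _ hne ?_
      dsimp only
      rw [smul_smul]
      convert h using 2 <;> ring
    rw [Gr.pderiv_sub, h', Gr.pderiv_smul, pderiv_hi_fermGauss, Gr.mul_sub, Gr.mul_smul, smul_sub,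
      smul_comm (-(1 / 2) : ℂ)]

end FermionicFourier


section GaussianPolynomials

variable {m : ℕ}

/-- The value of the polynomial `p` at a real point. -/
def evalR (p : MvPolynomial (Fin m) ℂ) (x : Fin m → ℝ) : ℂ :=
  MvPolynomial.eval (fun i => ((x i : ℝ) : ℂ)) p

/-- The bosonic Gaussian `exp(-(x_1²+⋯+x_m²)/2)`. -/
def bosGauss (m : ℕ) (x : Fin m → ℝ) : ℂ :=
  ((Real.exp (-(∑ i : Fin m, (x i) ^ 2) / 2) : ℝ) : ℂ)

/-- The product of a polynomial with the bosonic Gaussian. -/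
def gaussPoly (p : MvPolynomial (Fin m) ℂ) (x : Fin m → ℝ) : ℂ := evalR p x * bosGauss m x

/-- The polynomial counterpart of `∂_{x_i}` acting on polynomial multiples of the Gaussian. -/
def gaussDeriv (i : Fin m) (p : MvPolynomial (Fin m) ℂ) : MvPolynomial (Fin m) ℂ :=
  MvPolynomial.pderiv i p - MvPolynomial.X i * p

/-- The complex-valued real-linear coordinate form `x ↦ x_i`. -/
def coordC (i : Fin m) : (Fin m → ℝ) →L[ℝ] ℂ :=
  Complex.ofRealCLM.comp (ContinuousLinearMap.proj i)

@[simp] theorem coordC_apply (i : Fin m) (x : Fin m → ℝ) : coordC i x = (x i : ℂ) := rfl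

theorem gaussPoly_add (p q : MvPolynomial (Fin m) ℂ) (x : Fin m → ℝ) :
    gaussPoly (p + q) x = gaussPoly p x + gaussPoly q x := by
  simp [gaussPoly, evalR, add_mul]

theorem gaussPoly_smul (c : ℂ) (p : MvPolynomial (Fin m) ℂ) (x : Fin m → ℝ) :
    gaussPoly (c • p) x = c * gaussPoly p x := by
  simp [gaussPoly, evalR, mul_assoc]

theorem gaussPoly_X_mul (i : Fin m) (p : MvPolynomial (Fin m) ℂ) (x : Fin m → ℝ) :
    gaussPoly (MvPolynomial.X i * p) x = (x i : ℂ) * gaussPoly p x := by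
  simp [gaussPoly, evalR, mul_assoc]

theorem hasFDerivAt_evalR (p : MvPolynomial (Fin m) ℂ) (x : Fin m → ℝ) :
    HasFDerivAt (evalR p) (∑ i, evalR (MvPolynomial.pderiv i p) x • coordC i) x := by
  induction p using MvPolynomial.induction_on with
  | C c =>
    have : evalR (m := m) (MvPolynomial.C c) = fun _ => c := by ext; simp [evalR]
    rw [this]
    refine (hasFDerivAt_const (𝕜 := ℝ) c x).congr_fderiv ?_
    ext v
    simp [evalR]
  | add p q hp hq =>
    have : evalR (p + q) = fun y => evalR p y + evalR q y := by ext; simp [evalR]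
    rw [this]
    refine (hp.add hq).congr_fderiv ?_
    ext v
    simp [evalR, add_mul, Finset.sum_add_distrib]
  | mul_X p j hp =>
    have : evalR (p * MvPolynomial.X j) = fun y => evalR p y * coordC j y := by
      ext; simp [evalR]
    rw [this]
    refine (hp.mul (coordC j).hasFDerivAt).congr_fderiv ?_
    ext v
    have h (i : Fin m) : evalR (Pi.single (M := fun _ => MvPolynomial (Fin m) ℂ) i 1 j) x =
        if j = i then 1 else 0 := by
      rw [Pi.single_apply]; split_ifs <;> simp [evalR]
    simp only [evalR] at h
    simp [evalR, MvPolynomial.pderiv_X, h, add_mul, Finset.sum_add_distrib, Finset.mul_sum]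
    exact Finset.sum_congr rfl fun i _ => by ring

theorem hasFDerivAt_bosGauss (x : Fin m → ℝ) :
    HasFDerivAt (bosGauss m) (∑ i, (-(x i : ℂ) * bosGauss m x) • coordC i) x := by
  have h1 : HasFDerivAt (fun y : Fin m → ℝ => -(∑ i, coordC i y ^ 2) / 2)
      (∑ i, (-(x i : ℂ)) • coordC i) x := by
    have h := (HasFDerivAt.fun_sum (u := univ) fun i _ =>
      ((coordC i).hasFDerivAt (x := x)).pow 2).neg.mul_const (2⁻¹ : ℂ)
    simp only [div_eq_mul_inv]
    refine h.congr_fderiv ?_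
    ext v
    simp [Finset.mul_sum]
    refine Finset.sum_congr rfl fun i _ => ?_
    ring
  have h2 : bosGauss m = fun y => Complex.exp (-(∑ i, coordC i y ^ 2) / 2) := by
    ext y; simp [bosGauss]
  rw [h2]
  refine h1.cexp.congr_fderiv ?_
  simp [Finset.smul_sum, smul_smul, mul_comm]

theorem hasFDerivAt_gaussPoly (p : MvPolynomial (Fin m) ℂ) (x : Fin m → ℝ) :
    HasFDerivAt (gaussPoly p) (∑ i, gaussPoly (gaussDeriv i p) x • coordC i) x := by
  refine ((hasFDerivAt_evalR p x).mul (hasFDerivAt_bosGauss x)).congr_fderiv ?_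
  ext v
  simp only [add_apply, smul_apply, _root_.sum_apply,
    Finset.smul_sum, ← Finset.sum_add_distrib, smul_eq_mul]
  refine Finset.sum_congr rfl fun i _ => ?_
  simp [gaussPoly, gaussDeriv, evalR]
  ring

theorem sum_smul_coordC_single (c : Fin m → ℂ) (i : Fin m) :
    (∑ j, c j • coordC j) (Pi.single i 1) = c i := by
  rw [_root_.sum_apply, Finset.sum_eq_single i] <;>
    simp +contextual

theorem fderiv_gaussPoly (p : MvPolynomial (Fin m) ℂ) (x : Fin m → ℝ) (i : Fin m) :
    fderiv ℝ (gaussPoly p) x (Pi.single i 1) = gaussPoly (gaussDeriv i p) x := by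
  rw [(hasFDerivAt_gaussPoly p x).fderiv, sum_smul_coordC_single]

theorem integrable_gaussPoly (p : MvPolynomial (Fin m) ℂ) : Integrable (gaussPoly p) := by
  have h1 (k : ℕ) : Integrable fun t : ℝ => ((t ^ k * Real.exp (-(1 / 2) * t ^ 2) : ℝ) : ℂ) := by
    have := integrable_rpow_mul_exp_neg_mul_sq (b := 1 / 2) (by norm_num) (s := (k : ℝ))
      (by have : (0 : ℝ) ≤ k := k.cast_nonneg
          linarith)
    simp only [Real.rpow_natCast] at this
    exact this.ofReal
  have h2 (d : Fin m →₀ ℕ) : Integrable (gaussPoly (MvPolynomial.monomial d (1 : ℂ))) := by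
    convert! Integrable.fintype_prod (μ := fun _ => volume) fun i => h1 (d i) using 1
    funext x
    have h : -(∑ i, x i ^ 2) / 2 = ∑ i, -(1 / 2) * x i ^ 2 := by
      rw [← Finset.mul_sum]; ring
    rw [gaussPoly, evalR, bosGauss, h, Real.exp_sum]
    simp [MvPolynomial.eval_monomial, Finsupp.prod_fintype, Finset.prod_mul_distrib]
  induction p using MvPolynomial.induction_on' with
  | monomial d c =>
    have : gaussPoly (MvPolynomial.monomial d c) =
        fun x => c * gaussPoly (MvPolynomial.monomial d (1 : ℂ)) x := by
      ext x; rw [← gaussPoly_smul, MvPolynomial.smul_monomial, smul_eq_mul, mul_one]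
    rw [this]
    exact (h2 d).const_mul c
  | add p q hp hq =>
    have : gaussPoly (p + q) = fun x => gaussPoly p x + gaussPoly q x := by
      ext x; exact gaussPoly_add p q x
    rw [this]
    exact hp.add hq

theorem integrable_smul_coordC {f : (Fin m → ℝ) → ℂ} (hf : Integrable f) (i : Fin m) :
    Integrable fun x => f x • coordC i :=
  Integrable.smul_const hf (coordC i)

theorem integrable_sum_smul_coordC {f : Fin m → (Fin m → ℝ) → ℂ} (hf : ∀ i, Integrable (f i)) :
    Integrable fun x => ∑ i, f i x • coordC i :=
  integrable_finsetSum (f := fun i x => f i x • coordC i) univ fun i _ =>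
    integrable_smul_coordC (hf i) i

end GaussianPolynomials

section BosonicFourier

variable {m : ℕ} {σ : ℂ}

/-- The bosonic Fourier kernel `exp(σ i Σ_i x_i y_i)`. -/
def phase (σ : ℂ) (y x : Fin m → ℝ) : ℂ :=
  Complex.exp (σ * Complex.I * ∑ i, (x i : ℂ) * (y i : ℂ))

theorem phase_comm (σ : ℂ) (y x : Fin m → ℝ) : phase σ y x = phase σ x y := by
  simp only [phase, mul_comm]

theorem norm_phase (hσ : σ = 1 ∨ σ = -1) (y x : Fin m → ℝ) : ‖phase σ y x‖ = 1 := by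
  have h : (∑ i, (x i : ℂ) * (y i : ℂ)) = ((∑ i, x i * y i : ℝ) : ℂ) := by push_cast; rfl
  rw [phase, Complex.norm_exp, h]
  rcases hσ with rfl | rfl <;> simp

theorem hasFDerivAt_phase (y x : Fin m → ℝ) :
    HasFDerivAt (phase σ y) (∑ i, (σ * Complex.I * y i * phase σ y x) • coordC i) x := by
  have h1 : HasFDerivAt (fun z : Fin m → ℝ => σ * Complex.I * ∑ i, coordC i z * (y i : ℂ))
      (∑ i, (σ * Complex.I * y i) • coordC i) x := by
    refine ((HasFDerivAt.fun_sum (u := univ) fun i _ =>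
      ((coordC i).hasFDerivAt (x := x)).mul_const (y i : ℂ)).const_mul
        (σ * Complex.I)).congr_fderiv ?_
    simp [Finset.smul_sum, smul_smul]
  refine h1.cexp.congr_fderiv ?_
  rw [Finset.smul_sum]
  refine Finset.sum_congr rfl fun i _ => ?_
  rw [smul_smul, mul_comm]
  rfl

theorem continuous_phase (y : Fin m → ℝ) : Continuous (phase σ y) :=
  continuous_iff_continuousAt.2 fun x => (hasFDerivAt_phase y x).continuousAt

theorem integrable_phase_mul (hσ : σ = 1 ∨ σ = -1) (y : Fin m → ℝ)
    (p : MvPolynomial (Fin m) ℂ) : Integrable fun x => phase σ y x * gaussPoly p x :=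
  (integrable_gaussPoly p).bdd_mul (c := 1) (continuous_phase y).aestronglyMeasurable
    (.of_forall fun x => (norm_phase hσ y x).le)

/-- The unnormalised bosonic Fourier transform of a polynomial multiple of the Gaussian. -/
def polyFT (σ : ℂ) (p : MvPolynomial (Fin m) ℂ) (y : Fin m → ℝ) : ℂ :=
  ∫ x, phase σ y x * gaussPoly p x

theorem polyFT_add (hσ : σ = 1 ∨ σ = -1) (p q : MvPolynomial (Fin m) ℂ) (y : Fin m → ℝ) :
    polyFT σ (p + q) y = polyFT σ p y + polyFT σ q y := by
  simp only [polyFT, gaussPoly_add, mul_add]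
  exact integral_add (integrable_phase_mul hσ y p) (integrable_phase_mul hσ y q)

theorem polyFT_smul (c : ℂ) (p : MvPolynomial (Fin m) ℂ) (y : Fin m → ℝ) :
    polyFT σ (c • p) y = c * polyFT σ p y := by
  simp only [polyFT, gaussPoly_smul, mul_left_comm _ c]
  exact integral_const_mul _ _

theorem polyFT_gaussDeriv (hσ : σ = 1 ∨ σ = -1) (i : Fin m) (p : MvPolynomial (Fin m) ℂ)
    (y : Fin m → ℝ) :
    polyFT σ (gaussDeriv i p) y = -(σ * Complex.I) * (y i * polyFT σ p y) := by
  have hphase (x : Fin m → ℝ) :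
      fderiv ℝ (phase σ y) x (Pi.single i 1) = σ * Complex.I * y i * phase σ y x := by
    rw [(hasFDerivAt_phase y x).fderiv, sum_smul_coordC_single]
  have key := integral_mul_fderiv_eq_neg_fderiv_mul_of_integrable (μ := volume)
    (f := phase σ y) (g := gaussPoly p) (v := Pi.single i 1)
    (by simp only [hphase, mul_assoc]
        exact ((((integrable_phase_mul hσ y p).const_mul _).const_mul _).const_mul _))
    (by simp only [fderiv_gaussPoly]; exact integrable_phase_mul hσ y _)
    (integrable_phase_mul hσ y p)
    (fun x _ => (hasFDerivAt_phase y x).differentiableAt)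
    (fun x _ => (hasFDerivAt_gaussPoly p x).differentiableAt)
  simp only [fderiv_gaussPoly, hphase, mul_assoc] at key
  simp only [polyFT, key, integral_const_mul]
  ring

theorem hasFDerivAt_polyFT (hσ : σ = 1 ∨ σ = -1) (p : MvPolynomial (Fin m) ℂ)
    (y : Fin m → ℝ) :
    HasFDerivAt (polyFT σ p)
      (∫ x, ∑ i, (σ * Complex.I * (phase σ y x * gaussPoly (MvPolynomial.X i * p) x)) • coordC i)
      y := by
  have hσn : ‖σ‖ = 1 := by rcases hσ with rfl | rfl <;> simp
  have hint : Integrable fun x => ∑ i,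
      (σ * Complex.I * (phase σ y x * gaussPoly (MvPolynomial.X i * p) x)) • coordC i :=
    integrable_sum_smul_coordC fun i => (integrable_phase_mul hσ y _).const_mul _
  have hbound : Integrable fun x => ∑ i : Fin m,
      ‖gaussPoly (MvPolynomial.X i * p) x‖ * ‖(coordC i : (Fin m → ℝ) →L[ℝ] ℂ)‖ :=
    integrable_finsetSum _ fun i _ => (integrable_gaussPoly _).norm.mul_const _
  have hle (x z : Fin m → ℝ) :
      ‖∑ i, (σ * Complex.I * (phase σ z x * gaussPoly (MvPolynomial.X i * p) x)) • coordC i‖ ≤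
        ∑ i : Fin m,
          ‖gaussPoly (MvPolynomial.X i * p) x‖ * ‖(coordC i : (Fin m → ℝ) →L[ℝ] ℂ)‖ := by
    refine (norm_sum_le _ _).trans (Finset.sum_le_sum fun i _ => ?_)
    rw [norm_smul, norm_mul, norm_mul, norm_mul, norm_phase hσ, hσn, Complex.norm_I, one_mul,
      one_mul, one_mul]
  have hderiv (x z : Fin m → ℝ) : HasFDerivAt (fun w => phase σ w x * gaussPoly p x)
      (∑ i, (σ * Complex.I * (phase σ z x * gaussPoly (MvPolynomial.X i * p) x)) • coordC i)
      z := by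
    simp only [phase_comm σ _ x]
    refine ((hasFDerivAt_phase x z).mul_const (gaussPoly p x)).congr_fderiv ?_
    rw [Finset.smul_sum]
    refine Finset.sum_congr rfl fun i _ => ?_
    rw [smul_smul, gaussPoly_X_mul]
    congr 1
    ring
  exact hasFDerivAt_integral_of_dominated_of_fderiv_le (s := Set.univ) (μ := volume)
    Filter.univ_mem
    (.of_forall fun z => (integrable_phase_mul hσ z p).aestronglyMeasurable)
    (integrable_phase_mul hσ y p) hint.aestronglyMeasurable
    (.of_forall fun x z _ => hle x z) hbound (.of_forall fun x z _ => hderiv x z)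

theorem fderiv_polyFT (hσ : σ = 1 ∨ σ = -1) (p : MvPolynomial (Fin m) ℂ) (y : Fin m → ℝ)
    (i : Fin m) :
    fderiv ℝ (polyFT σ p) y (Pi.single i 1) =
      σ * Complex.I * polyFT σ (MvPolynomial.X i * p) y := by
  rw [(hasFDerivAt_polyFT hσ p y).fderiv, integral_finsetSum _ fun j _ =>
    integrable_smul_coordC ((integrable_phase_mul hσ y _).const_mul _) j]
  simp only [integral_smul_const, sum_smul_coordC_single, integral_const_mul, polyFT]

theorem polyFT_one (hσ : σ = 1 ∨ σ = -1) (y : Fin m → ℝ) :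
    polyFT σ 1 y = (2 * Real.pi : ℂ) ^ (m / 2 : ℂ) * bosGauss m y := by
  have h := GaussianFourier.integral_cexp_neg_mul_sum_add (b := 1 / 2) (by norm_num)
    fun i : Fin m => σ * Complex.I * y i
  have hs : (σ * Complex.I) ^ 2 = -1 := by rcases hσ with rfl | rfl <;> simp
  have e : (∑ i, (σ * Complex.I * y i) ^ 2) / (4 * (1 / 2)) = -(∑ i, (y i : ℂ) ^ 2) / 2 := by
    simp only [mul_pow, hs, ← Finset.mul_sum]
    ring
  have e2 : (Real.pi : ℂ) / (1 / 2) = 2 * Real.pi := by ring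
  rw [Fintype.card_fin, e, e2] at h
  convert h using 1
  · refine integral_congr_ae (.of_forall fun x => ?_)
    simp only [phase, gaussPoly, evalR, bosGauss, map_one, one_mul, Complex.ofReal_exp]
    rw [← Complex.exp_add]
    congr 1
    push_cast
    rw [Finset.mul_sum, add_comm]
    congr 1
    · ring
    · exact Finset.sum_congr rfl fun i _ => by ring
  · simp [bosGauss]

end BosonicFourier


namespace Gr

theorem gen_mul_gen_mul {R : Type} [CommRing R] {N : ℕ} (i j : Fin N) (f : Gr R N) :
    mul (gen i) (mul (gen j) f) = -mul (gen j) (mul (gen i) f) := by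
  ext s
  rw [Pi.neg_apply]
  simp only [gen_mul_apply, Finset.mem_erase]
  by_cases hij : i = j
  · subst hij; simp
  by_cases hi : i ∈ s
  · by_cases hj : j ∈ s
    · have h1 := lsign_insert (R := R) i (Finset.notMem_erase j s)
      have h2 := lsign_insert (R := R) j (Finset.notMem_erase i s)
      rw [Finset.insert_erase hj] at h1
      rw [Finset.insert_erase hi] at h2
      rw [if_pos hi, if_pos hj, if_pos ⟨Ne.symm hij, hj⟩, if_pos ⟨hij, hi⟩, h1, h2,
        Finset.erase_right_comm]
      rcases lt_or_gt_of_ne hij with h | h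
      · simp only [h, h.not_gt, if_true, if_false]; ring
      · simp only [h, h.not_gt, if_true, if_false]; ring
    · simp [hj]
  · simp [hi]

end Gr

section PolynomialOperators

variable {m n : ℕ}

/-- The inclusion of `Λ_{2n}` into `ℂ[x_1,…,x_m] ⊗ Λ_{2n}`. -/
def constPG (m : ℕ) (a : Gr ℂ (2 * n)) : PG m n := fun s => MvPolynomial.C (a s)

theorem constPG_gen (t : Fin (2 * n)) : constPG m (Gr.gen t) = Gr.gen t := by
  ext1 s; simp only [constPG, Gr.gen]; split_ifs <;> simp

/-- Left multiplication by an element of `Λ_{2n}`. -/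
def grMul (m : ℕ) (a : Gr ℂ (2 * n)) : PG m n →ₗ[ℂ] PG m n :=
  (Gr.mulL (constPG m a)).restrictScalars ℂ

/-- The fermionic derivative `∂_{x`_t}`. -/
def grDeriv (m : ℕ) (t : Fin (2 * n)) : PG m n →ₗ[ℂ] PG m n :=
  (Gr.pderivL t).restrictScalars ℂ

/-- Multiplication by the commuting variable `x_i`. -/
def coordMul (n : ℕ) (i : Fin m) : PG m n →ₗ[ℂ] PG m n :=
  ((LinearMap.lsmul (MvPolynomial (Fin m) ℂ) (PG m n)) (MvPolynomial.X i)).restrictScalars ℂ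

/-- The bosonic derivative `∂_{x_i}`. -/
def polDeriv (n : ℕ) (i : Fin m) : PG m n →ₗ[ℂ] PG m n :=
  (MvPolynomial.pderiv i).toLinearMap.compLeft _

theorem grMul_apply (a : Gr ℂ (2 * n)) (P : PG m n) :
    grMul m a P = Gr.mul (constPG m a) P := rfl

theorem grMul_gen (t : Fin (2 * n)) (P : PG m n) :
    grMul m (Gr.gen t) P = Gr.mul (Gr.gen t) P := by
  rw [grMul_apply, constPG_gen]

theorem grDeriv_apply (t : Fin (2 * n)) (P : PG m n) : grDeriv m t P = Gr.pderiv t P := rfl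

theorem coordMul_apply (i : Fin m) (P : PG m n) (s : Finset (Fin (2 * n))) :
    coordMul n i P s = MvPolynomial.X i * P s := rfl

theorem polDeriv_apply (i : Fin m) (P : PG m n) (s : Finset (Fin (2 * n))) :
    polDeriv n i P s = MvPolynomial.pderiv i (P s) := rfl

theorem map_grMul (l : MvPolynomial (Fin m) ℂ →ₗ[ℂ] ℂ) (a : Gr ℂ (2 * n)) (P : PG m n) :
    (fun s => l (grMul m a P s)) = Gr.mul a fun s => l (P s) := by
  ext s
  simp only [grMul_apply, Gr.mul, map_sum]
  refine Finset.sum_congr rfl fun A _ => ?_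
  have h : (Gr.msign A (s \ A) : MvPolynomial (Fin m) ℂ) * constPG m a A * P (s \ A) =
      ((Gr.msign A (s \ A) : ℂ) * a A) • P (s \ A) := by
    simp [MvPolynomial.smul_eq_C_mul, constPG, Gr.msign]
  rw [h, map_smul, smul_eq_mul]

theorem map_grDeriv (l : MvPolynomial (Fin m) ℂ →ₗ[ℂ] ℂ) (t : Fin (2 * n)) (P : PG m n) :
    (fun s => l (grDeriv m t P s)) = Gr.pderiv t fun s => l (P s) := by
  ext s
  simp only [grDeriv_apply, Gr.pderiv]
  split_ifs
  · simp
  · rw [← smul_eq_mul _ (l _), ← map_smul, MvPolynomial.smul_eq_C_mul]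
    simp

theorem grMul_gen_grMul_gen (i j : Fin (2 * n)) (P : PG m n) :
    grMul m (Gr.gen i) (grMul m (Gr.gen j) P) = -grMul m (Gr.gen j) (grMul m (Gr.gen i) P) := by
  simp only [grMul_gen, Gr.gen_mul_gen_mul i j P]

end PolynomialOperators

section GaussianPG

variable {m n : ℕ}

/-- The product of an element of `ℂ[x_1,…,x_m] ⊗ Λ_{2n}` with the bosonic Gaussian. -/
def gaussPG (m n : ℕ) : PG m n →ₗ[ℂ] SF m n where
  toFun P x s := gaussPoly (P s) x
  map_add' P Q := by ext x s; exact gaussPoly_add _ _ x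
  map_smul' c P := by ext x s; exact gaussPoly_smul c _ x

theorem gaussPG_apply (P : PG m n) (x : Fin m → ℝ) (s : Finset (Fin (2 * n))) :
    gaussPG m n P x s = gaussPoly (P s) x := rfl

/-- Evaluation of polynomial multiples of the Gaussian, as a linear form. -/
def gaussPolyL (x : Fin m → ℝ) : MvPolynomial (Fin m) ℂ →ₗ[ℂ] ℂ where
  toFun p := gaussPoly p x
  map_add' p q := gaussPoly_add p q x
  map_smul' c p := gaussPoly_smul c p x

theorem gaussPG_grMul (a : Gr ℂ (2 * n)) (P : PG m n) (x : Fin m → ℝ) :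
    gaussPG m n (grMul m a P) x = Gr.mul a (gaussPG m n P x) := map_grMul (gaussPolyL x) a P

theorem gaussPG_grDeriv (t : Fin (2 * n)) (P : PG m n) (x : Fin m → ℝ) :
    gaussPG m n (grDeriv m t P) x = Gr.pderiv t (gaussPG m n P x) :=
  map_grDeriv (gaussPolyL x) t P

theorem gaussPG_coordMul (i : Fin m) (P : PG m n) (x : Fin m → ℝ) :
    gaussPG m n (coordMul n i P) x = (x i : ℂ) • gaussPG m n P x := by
  ext s; exact gaussPoly_X_mul i (P s) x

theorem bderiv_gaussPG (i : Fin m) (P : PG m n) :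
    bderiv m n i (gaussPG m n P) = gaussPG m n (polDeriv n i P - coordMul n i P) := by
  ext x s; exact fderiv_gaussPoly (P s) x i

theorem gaussPG_grMul_fermGauss (H : PG m n) :
    gaussPG m n (grMul m (fermGauss n) H) =
      fun x => Gr.mul (evalP m n H x) (gaussFun m n x) := by
  ext1 x
  have h : gaussPG m n H x = bosGauss m x • evalP m n H x := by
    ext s; exact mul_comm _ _
  rw [gaussPG_grMul, h, Gr.mul_smul, gaussFun, Gr.mul_smul, isEven_fermGauss.mul_comm]
  rfl

end GaussianPG

section FourierRules

variable {m n : ℕ} {σ : ℂ}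

/-- The unnormalised bosonic Fourier transform at a point, as a linear form. -/
def polyFTL (hσ : σ = 1 ∨ σ = -1) (y : Fin m → ℝ) : MvPolynomial (Fin m) ℂ →ₗ[ℂ] ℂ where
  toFun p := polyFT σ p y
  map_add' p q := polyFT_add hσ p q y
  map_smul' c p := polyFT_smul c p y

theorem kernelMap_eq_sum (g : Gr ℂ (2 * n)) (s : Finset (Fin (2 * n))) :
    kernelMap n σ g s = ∑ A, kernelMap n σ (Pi.single A 1) s * g A := by
  rw [LinearMap.pi_apply_eq_sum_univ (kernelMap n σ) g, Finset.sum_apply]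
  refine Finset.sum_congr rfl fun A _ => ?_
  rw [Pi.smul_apply, smul_eq_mul, mul_comm]
  have h : (Pi.single A 1 : Gr ℂ (2 * n)) = fun B => if A = B then 1 else 0 := by
    ext B; simp [Pi.single_apply, eq_comm]
  rw [h]

/-- The normalising constant `(2π)^{-M/2}` of the super Fourier transform. -/
def normFT (m n : ℕ) : ℂ := ((2 * Real.pi : ℝ) : ℂ) ^ ((-((m : ℂ) - 2 * (n : ℂ))) / 2)

theorem superFT_gaussPG (hσ : σ = 1 ∨ σ = -1) (P : PG m n) (y : Fin m → ℝ) :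
    superFT m n σ (gaussPG m n P) y =
      normFT m n • kernelMap n σ (fun A => polyFT σ (P A) y) := by
  ext s
  have h (x : Fin m → ℝ) : phase σ y x * kernelMap n σ (gaussPG m n P x) s =
      ∑ A, kernelMap n σ (Pi.single A 1) s * (phase σ y x * gaussPoly (P A) x) := by
    rw [kernelMap_eq_sum, Finset.mul_sum]
    exact Finset.sum_congr rfl fun A _ => mul_left_comm _ _ _
  rw [Pi.smul_apply, smul_eq_mul, kernelMap_eq_sum]
  change normFT m n * ∫ x, phase σ y x * kernelMap n σ (gaussPG m n P x) s = _
  simp only [h]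
  rw [integral_finsetSum univ fun A _ => (integrable_phase_mul hσ y (P A)).const_mul _]
  simp only [integral_const_mul, polyFT]

theorem bderiv_superFT_gaussPG (hσ : σ = 1 ∨ σ = -1) (i : Fin m) (P : PG m n) :
    bderiv m n i (superFT m n σ (gaussPG m n P)) =
      (σ * Complex.I) • superFT m n σ (gaussPG m n (coordMul n i P)) := by
  ext y s
  have h : (fun t => superFT m n σ (gaussPG m n P) t s) = fun t =>
      ∑ A, (normFT m n * kernelMap n σ (Pi.single A 1) s) * polyFT σ (P A) t := by
    ext t
    rw [superFT_gaussPG hσ, Pi.smul_apply, kernelMap_eq_sum, smul_eq_mul, Finset.mul_sum]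
    simp only [mul_assoc]
  rw [bderiv, h, fderiv_fun_sum fun A _ =>
    ((hasFDerivAt_polyFT hσ (P A) y).differentiableAt.const_mul _)]
  rw [_root_.sum_apply, Pi.smul_apply, Pi.smul_apply, superFT_gaussPG hσ,
    Pi.smul_apply, kernelMap_eq_sum, Finset.smul_sum, Finset.smul_sum]
  refine Finset.sum_congr rfl fun A _ => ?_
  rw [fderiv_const_mul (hasFDerivAt_polyFT hσ (P A) y).differentiableAt,
    smul_apply, fderiv_polyFT hσ, coordMul_apply]
  simp only [smul_eq_mul]
  ring

/-- `Q` times the Gaussian is the super Fourier transform of `P` times the Gaussian. -/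
def IsFT (σ : ℂ) (P Q : PG m n) : Prop := superFT m n σ (gaussPG m n P) = gaussPG m n Q

theorem isFT_iff (hσ : σ = 1 ∨ σ = -1) {P Q : PG m n} :
    IsFT σ P Q ↔ ∀ y,
      normFT m n • kernelMap n σ (fun A => polyFT σ (P A) y) = gaussPG m n Q y := by
  simp only [IsFT, funext_iff (f := superFT m n σ _), superFT_gaussPG hσ]

namespace IsFT

variable {P Q P' Q' : PG m n}

theorem of_linear (hσ : σ = 1 ∨ σ = -1) (h : IsFT σ P Q) {c : ℂ}
    (L : Gr ℂ (2 * n) →ₗ[ℂ] Gr ℂ (2 * n))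
    (hP : ∀ y, kernelMap n σ (fun A => polyFT σ (P' A) y) =
      c • L (kernelMap n σ fun A => polyFT σ (P A) y))
    (hQ : ∀ y, gaussPG m n Q' y = L (gaussPG m n Q y)) : IsFT σ P' (c • Q') := by
  rw [isFT_iff hσ] at h ⊢
  intro y
  rw [hP, smul_comm, ← map_smul, h, map_smul, Pi.smul_apply, hQ]

theorem add (hσ : σ = 1 ∨ σ = -1) (h : IsFT σ P Q) (h' : IsFT σ P' Q') :
    IsFT σ (P + P') (Q + Q') := by
  rw [isFT_iff hσ] at h h' ⊢
  intro y
  rw [map_add, Pi.add_apply, ← h, ← h', ← smul_add, ← map_add]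
  congr 2
  ext A
  exact polyFT_add hσ _ _ y

theorem smul (hσ : σ = 1 ∨ σ = -1) (c : ℂ) (h : IsFT σ P Q) : IsFT σ (c • P) (c • Q) := by
  refine h.of_linear hσ LinearMap.id (fun y => ?_) fun y => rfl
  rw [LinearMap.id_apply, ← map_smul]
  congr 1
  ext A
  exact polyFT_smul _ _ y

theorem sub (hσ : σ = 1 ∨ σ = -1) (h : IsFT σ P Q) (h' : IsFT σ P' Q') :
    IsFT σ (P - P') (Q - Q') := by
  simpa [sub_eq_add_neg] using h.add hσ (h'.smul hσ (-1))

theorem sum (hσ : σ = 1 ∨ σ = -1) {ι : Type} {I : Finset ι} {P Q : ι → PG m n}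
    (h : ∀ i ∈ I, IsFT σ (P i) (Q i)) : IsFT σ (∑ i ∈ I, P i) (∑ i ∈ I, Q i) := by
  classical
  induction I using Finset.induction_on with
  | empty =>
    have h0 : IsFT σ (0 : PG m n) 0 := by
      rw [isFT_iff hσ]
      intro y
      have : (fun A => polyFT σ ((0 : PG m n) A) y) = 0 := by
        ext A; exact (polyFTL hσ y).map_zero
      rw [this, map_zero, map_zero, smul_zero]
      rfl
    simpa using h0
  | insert i I hi ih =>
    rw [Finset.sum_insert hi, Finset.sum_insert hi]
    exact (h i (Finset.mem_insert_self _ _)).add hσ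
      (ih fun j hj => h j (Finset.mem_insert_of_mem hj))

theorem coordMul (hσ : σ = 1 ∨ σ = -1) (h : IsFT σ P Q) (i : Fin m) :
    IsFT σ (coordMul n i P) (-(σ * Complex.I) • (polDeriv n i Q - _root_.coordMul n i Q)) := by
  have hs : -(σ * Complex.I) * (σ * Complex.I) = 1 := by
    rcases hσ with rfl | rfl <;> simp
  have h1 := bderiv_superFT_gaussPG hσ i P
  rw [IsFT] at h ⊢
  rw [map_smul, ← bderiv_gaussPG, ← h, h1, smul_smul, hs, one_smul]

theorem gaussDeriv (hσ : σ = 1 ∨ σ = -1) (h : IsFT σ P Q) (i : Fin m) :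
    IsFT σ (polDeriv n i P - _root_.coordMul n i P) (-(σ * Complex.I) • _root_.coordMul n i Q) := by
  rw [isFT_iff hσ] at h ⊢
  intro y
  have hy : (fun A => polyFT σ ((polDeriv n i P - _root_.coordMul n i P) A) y) =
      (-(σ * Complex.I) * y i) • fun A => polyFT σ (P A) y := by
    ext A
    rw [Pi.smul_apply, smul_eq_mul, mul_assoc]
    exact polyFT_gaussDeriv hσ i (P A) y
  rw [hy, map_smul, map_smul, Pi.smul_apply, gaussPG_coordMul, ← h, smul_smul, smul_smul,
    smul_smul]
  congr 1
  ring

theorem grDeriv_lo (hσ : σ = 1 ∨ σ = -1) (h : IsFT σ P Q) (j : Fin n) :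
    IsFT σ (grDeriv m (lo n j) P) ((σ * Complex.I / 2) • grMul m (Gr.gen (hi n j)) Q) :=
  h.of_linear hσ (Gr.mulL (Gr.gen (hi n j)))
    (fun y => (congrArg _ (map_grDeriv (polyFTL hσ y) _ P)).trans (kernelMap_pderiv_lo σ j _))
    (gaussPG_grMul _ Q)

theorem grDeriv_hi (hσ : σ = 1 ∨ σ = -1) (h : IsFT σ P Q) (j : Fin n) :
    IsFT σ (grDeriv m (hi n j) P) (-(σ * Complex.I / 2) • grMul m (Gr.gen (lo n j)) Q) :=
  h.of_linear hσ (Gr.mulL (Gr.gen (lo n j)))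
    (fun y => (congrArg _ (map_grDeriv (polyFTL hσ y) _ P)).trans (kernelMap_pderiv_hi σ j _))
    (gaussPG_grMul _ Q)

theorem gen_lo (hσ : σ = 1 ∨ σ = -1) (h : IsFT σ P Q) (j : Fin n) :
    IsFT σ (grMul m (Gr.gen (lo n j)) P) (-(2 * (σ * Complex.I)) • grDeriv m (hi n j) Q) :=
  h.of_linear hσ (Gr.pderivL (hi n j))
    (fun y => (congrArg _ (map_grMul (polyFTL hσ y) _ P)).trans
      (kernelMap_gen_lo (sq_eq_one_iff.2 hσ) j _))
    (gaussPG_grDeriv _ Q)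

theorem gen_hi (hσ : σ = 1 ∨ σ = -1) (h : IsFT σ P Q) (j : Fin n) :
    IsFT σ (grMul m (Gr.gen (hi n j)) P) ((2 * (σ * Complex.I)) • grDeriv m (lo n j) Q) :=
  h.of_linear hσ (Gr.pderivL (lo n j))
    (fun y => (congrArg _ (map_grMul (polyFTL hσ y) _ P)).trans
      (kernelMap_gen_hi (sq_eq_one_iff.2 hσ) j _))
    (gaussPG_grDeriv _ Q)

end IsFT

theorem isFT_fermGauss (hσ : σ = 1 ∨ σ = -1) :
    IsFT σ (constPG m (fermGauss n)) (constPG m (fermGauss n)) := by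
  rw [isFT_iff hσ]
  intro y
  have hg : gaussPG m n (constPG m (fermGauss n)) y = bosGauss m y • fermGauss n := by
    ext A; simp [gaussPG_apply, constPG, gaussPoly, evalR, mul_comm]
  have hf : (fun A => polyFT σ (constPG m (fermGauss n) A) y) =
      ((2 * Real.pi : ℂ) ^ (m / 2 : ℂ) * bosGauss m y) • fermGauss n := by
    ext A
    rw [constPG, MvPolynomial.C_eq_smul_one, polyFT_smul, polyFT_one hσ, Pi.smul_apply,
      smul_eq_mul, mul_comm]
  have hpi : (2 * Real.pi : ℂ) ≠ 0 := by simp [Real.pi_ne_zero]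
  have hc : normFT m n * (2 * Real.pi : ℂ) ^ (m / 2 : ℂ) * ((2 * Real.pi : ℂ) ^ n)⁻¹ = 1 := by
    rw [normFT, ← Complex.cpow_natCast _ n, ← Complex.cpow_neg, Complex.ofReal_mul,
      Complex.ofReal_ofNat, ← Complex.cpow_add _ _ hpi, ← Complex.cpow_add _ _ hpi]
    convert Complex.cpow_zero _ using 2
    ring
  rw [hf, hg, map_smul, kernelMap_fermGauss (sq_eq_one_iff.2 hσ), smul_smul, smul_smul]
  congr 1
  linear_combination bosGauss m y * hc

end FourierRules


section WeylClifford

variable {m n : ℕ}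

theorem polDeriv_coordMul (i : Fin m) (P : PG m n) :
    polDeriv n i (coordMul n i P) = P + coordMul n i (polDeriv n i P) := by
  ext1 s
  simp only [polDeriv_apply, coordMul_apply, Pi.add_apply, Derivation.leibniz,
    MvPolynomial.pderiv_X_self, smul_eq_mul]
  ring

theorem pderiv_pderiv_comm (i j : Fin m) (p : MvPolynomial (Fin m) ℂ) :
    MvPolynomial.pderiv i (MvPolynomial.pderiv j p) =
      MvPolynomial.pderiv j (MvPolynomial.pderiv i p) := by
  ext d
  by_cases h : i = j
  · rw [h]
  · simp only [MvPolynomial.coeff_pderiv, Finsupp.add_apply, Finsupp.single_eq_of_ne h,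
      Finsupp.single_eq_of_ne (Ne.symm h), add_right_comm d, add_zero]
    ring

theorem polDeriv_comm (i j : Fin m) (P : PG m n) :
    polDeriv n i (polDeriv n j P) = polDeriv n j (polDeriv n i P) := by
  ext1 s; exact pderiv_pderiv_comm i j (P s)

theorem polDeriv_grDeriv (i : Fin m) (t : Fin (2 * n)) (P : PG m n) :
    polDeriv n i (grDeriv m t P) = grDeriv m t (polDeriv n i P) := by
  ext1 s
  simp only [polDeriv_apply, grDeriv_apply, Gr.pderiv]
  split_ifs
  · simp
  · rcases neg_one_pow_eq_or (MvPolynomial (Fin m) ℂ) #{i ∈ s | i < t} with h | h <;>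
      simp [h]

theorem polDeriv_grMul (i : Fin m) (a : Gr ℂ (2 * n)) (P : PG m n) :
    polDeriv n i (grMul m a P) = grMul m a (polDeriv n i P) := by
  ext1 s
  simp only [polDeriv_apply, grMul_apply, Gr.mul, map_sum]
  refine Finset.sum_congr rfl fun A _ => ?_
  have h : (Gr.msign A (s \ A) : MvPolynomial (Fin m) ℂ) * constPG m a A =
      MvPolynomial.C (Gr.msign A (s \ A) * a A) := by
    simp [constPG, Gr.msign]
  rw [h, MvPolynomial.pderiv_C_mul]

theorem coordMul_grMul (i : Fin m) (a : Gr ℂ (2 * n)) (P : PG m n) :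
    coordMul n i (grMul m a P) = grMul m a (coordMul n i P) :=
  (Gr.mul_smul _ _ _).symm

theorem grDeriv_gen (i t : Fin (2 * n)) (P : PG m n) :
    grDeriv m i (grMul m (Gr.gen t) P) =
      (if i = t then P else 0) - grMul m (Gr.gen t) (grDeriv m i P) := by
  rw [grMul_gen, grMul_gen]; exact Gr.pderiv_gen_mul i t P

theorem grDeriv_anticomm (i j : Fin (2 * n)) (P : PG m n) :
    grDeriv m i (grDeriv m j P) = -grDeriv m j (grDeriv m i P) := Gr.pderiv_pderiv i j P

theorem isEven_constPG {a : Gr ℂ (2 * n)} (ha : Gr.IsEven a) : Gr.IsEven (constPG m a) :=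
  fun s hs => ha s fun h => hs (by simp [constPG, h])

theorem grMul_grMul_gen {a : Gr ℂ (2 * n)} (ha : Gr.IsEven a) (t : Fin (2 * n)) (P : PG m n) :
    grMul m a (grMul m (Gr.gen t) P) = grMul m (Gr.gen t) (grMul m a P) :=
  (isEven_constPG ha).mul_left_comm _ _

theorem grDeriv_constPG (t : Fin (2 * n)) (a : Gr ℂ (2 * n)) :
    grDeriv m t (constPG m a) = constPG m (Gr.pderiv t a) := by
  ext1 s
  simp only [grDeriv_apply, constPG, Gr.pderiv]
  split_ifs <;> simp

theorem grDeriv_grMul {a : Gr ℂ (2 * n)} (ha : Gr.IsEven a) (t : Fin (2 * n)) (P : PG m n) :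
    grDeriv m t (grMul m a P) = grMul m (Gr.pderiv t a) P + grMul m a (grDeriv m t P) := by
  simp only [grMul_apply, ← grDeriv_constPG]
  exact (isEven_constPG ha).pderiv_mul t P

theorem grMul_smul_gen_mul (c : ℂ) (t : Fin (2 * n)) (a : Gr ℂ (2 * n)) (P : PG m n) :
    grMul m (c • Gr.mul (Gr.gen t) a) P = c • grMul m (Gr.gen t) (grMul m a P) := by
  have h : constPG m (c • Gr.mul (Gr.gen t) a) =
      (MvPolynomial.C c : MvPolynomial (Fin m) ℂ) • Gr.mul (Gr.gen t) (constPG m a) := by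
    ext1 s
    simp only [constPG, Pi.smul_apply, smul_eq_mul, Gr.gen_mul_apply]
    split_ifs <;> simp [Gr.lsign, apply_ite MvPolynomial.C]
  rw [grMul_apply, h, Gr.smul_mul, Gr.mul_assoc, grMul_gen, grMul_apply]
  ext1 s
  simp [MvPolynomial.smul_eq_C_mul]

theorem grDeriv_lo_grMul_fermGauss (j : Fin n) (P : PG m n) :
    grDeriv m (lo n j) (grMul m (fermGauss n) P) =
      (1 / 2 : ℂ) • grMul m (Gr.gen (hi n j)) (grMul m (fermGauss n) P) +
        grMul m (fermGauss n) (grDeriv m (lo n j) P) := by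
  rw [grDeriv_grMul isEven_fermGauss, pderiv_lo_fermGauss, grMul_smul_gen_mul]

theorem grDeriv_hi_grMul_fermGauss (j : Fin n) (P : PG m n) :
    grDeriv m (hi n j) (grMul m (fermGauss n) P) =
      (-(1 / 2) : ℂ) • grMul m (Gr.gen (lo n j)) (grMul m (fermGauss n) P) +
        grMul m (fermGauss n) (grDeriv m (hi n j) P) := by
  rw [grDeriv_grMul isEven_fermGauss, pderiv_hi_fermGauss, grMul_smul_gen_mul]

end WeylClifford

section Oscillator

variable {m n : ℕ}

/-- The lowering operator `∂_{x_i} - x_i`, acting on polynomial multiples of the Gaussian. -/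
def oscBos (n : ℕ) (i : Fin m) : PG m n →ₗ[ℂ] PG m n := polDeriv n i - (2 : ℂ) • coordMul n i

/-- The operator `∂_{x`_{2j-1}} + x`_{2j}/2`. -/
def oscLo (m : ℕ) (j : Fin n) : PG m n →ₗ[ℂ] PG m n :=
  grDeriv m (lo n j) + (1 / 2 : ℂ) • grMul m (Gr.gen (hi n j))

/-- The operator `∂_{x`_{2j}} - x`_{2j-1}/2`. -/
def oscHi (m : ℕ) (j : Fin n) : PG m n →ₗ[ℂ] PG m n :=
  grDeriv m (hi n j) - (1 / 2 : ℂ) • grMul m (Gr.gen (lo n j))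

/-- The operator induced by `O` on polynomial multiples of the bosonic Gaussian. -/
def oscPG (m n : ℕ) (P : PG m n) : PG m n :=
  (4 : ℂ) • ∑ j, oscLo m j (oscHi m j P) - ∑ i, oscBos n i (oscBos n i P)

theorem oscBos_oscBos (i : Fin m) (P : PG m n) :
    -oscBos n i (oscBos n i P) =
      -(polDeriv n i (polDeriv n i P - coordMul n i P) -
        coordMul n i (polDeriv n i P - coordMul n i P)) - coordMul n i (coordMul n i P) +
        (2 : ℂ) • coordMul n i (polDeriv n i P - coordMul n i P) + P := by
  simp only [oscBos, LinearMap.sub_apply, LinearMap.smul_apply, map_sub, map_smul,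
    polDeriv_coordMul]
  module

theorem oscLo_oscHi (j : Fin n) (P : PG m n) :
    (4 : ℂ) • oscLo m j (oscHi m j P) =
      (4 : ℂ) • grDeriv m (lo n j) (grDeriv m (hi n j) P) +
        grMul m (Gr.gen (lo n j)) (grMul m (Gr.gen (hi n j)) P) +
        (2 : ℂ) • (grMul m (Gr.gen (lo n j)) (grDeriv m (lo n j) P) +
          grMul m (Gr.gen (hi n j)) (grDeriv m (hi n j) P)) - (2 : ℂ) • P := by
  simp only [oscLo, oscHi, LinearMap.sub_apply, LinearMap.add_apply, LinearMap.smul_apply,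
    map_sub, map_smul, grDeriv_gen, if_true, grMul_gen_grMul_gen (hi n j) (lo n j)]
  module

theorem gaussPG_sum_apply {ι : Type} (I : Finset ι) (P : ι → PG m n) (x : Fin m → ℝ) :
    gaussPG m n (∑ i ∈ I, P i) x = ∑ i ∈ I, gaussPG m n (P i) x := by
  rw [map_sum, Finset.sum_apply]

theorem gaussPG_smul_apply (c : ℂ) (P : PG m n) (x : Fin m → ℝ) :
    gaussPG m n (c • P) x = c • gaussPG m n P x := by
  rw [map_smul, Pi.smul_apply]

theorem gaussPG_add_apply (P Q : PG m n) (x : Fin m → ℝ) :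
    gaussPG m n (P + Q) x = gaussPG m n P x + gaussPG m n Q x := by
  rw [map_add, Pi.add_apply]

theorem gaussPG_sub_apply (P Q : PG m n) (x : Fin m → ℝ) :
    gaussPG m n (P - Q) x = gaussPG m n P x - gaussPG m n Q x := by
  rw [map_sub, Pi.sub_apply]

theorem oscPG_eq (P : PG m n) : oscPG m n P =
    ((4 : ℂ) • ∑ j : Fin n, grDeriv m (lo n j) (grDeriv m (hi n j) P) -
      ∑ i, (polDeriv n i (polDeriv n i P - coordMul n i P) -
        coordMul n i (polDeriv n i P - coordMul n i P))) +
    (∑ j : Fin n, grMul m (Gr.gen (lo n j)) (grMul m (Gr.gen (hi n j)) P) -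
      ∑ i, coordMul n i (coordMul n i P)) +
    (2 : ℂ) • (∑ i, coordMul n i (polDeriv n i P - coordMul n i P) +
      ∑ t : Fin (2 * n), grMul m (Gr.gen t) (grDeriv m t P)) +
    ((m : ℂ) - 2 * n) • P := by
  rw [sum_lo_hi, oscPG, sub_eq_add_neg, Finset.smul_sum, ← Finset.sum_neg_distrib]
  simp only [oscLo_oscHi, oscBos_oscBos, Finset.sum_add_distrib, Finset.sum_sub_distrib,
    Finset.sum_neg_distrib, ← Finset.smul_sum, Finset.sum_const, Finset.card_univ,
    Fintype.card_fin, ← Nat.cast_smul_eq_nsmul ℂ]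
  module

theorem Oop_gaussPG (P : PG m n) : Oop m n (gaussPG m n P) = gaussPG m n (oscPG m n P) := by
  ext1 x
  rw [oscPG_eq, Oop, superLap, lapF, euler, xsqElem, xsq]
  simp only [bderiv_gaussPG, gaussPG_add_apply, gaussPG_sub_apply,
    gaussPG_smul_apply, gaussPG_sum_apply, gaussPG_grDeriv, gaussPG_grMul, gaussPG_coordMul,
    Gr.add_mul, Gr.smul_mul, Gr.sum_mul, Gr.mul_assoc, Gr.one_mul]
  simp only [neg_smul, Finset.sum_smul, smul_smul, pow_two, ← sub_eq_add_neg]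

theorem Oop_iterate_gaussPG (P : PG m n) (j : ℕ) :
    (Oop m n)^[j] (gaussPG m n P) = gaussPG m n ((oscPG m n)^[j] P) :=
  ((show Function.Semiconj (gaussPG m n) (oscPG m n) (Oop m n) from
    fun Q => (Oop_gaussPG Q).symm).iterate_right j P).symm

end Oscillator

section Eigenfunctions

variable {m n : ℕ} {σ : ℂ}

namespace IsFT

variable {P Q : PG m n}

theorem map_oscBos (hσ : σ = 1 ∨ σ = -1) (h : IsFT σ P Q) (i : Fin m) :
    IsFT σ (oscBos n i P) ((σ * Complex.I) • oscBos n i Q) := by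
  convert (h.gaussDeriv hσ i).sub hσ (h.coordMul hσ i) using 1 <;>
  · simp only [oscBos, LinearMap.sub_apply, LinearMap.smul_apply]
    module

theorem map_oscLo (hσ : σ = 1 ∨ σ = -1) (h : IsFT σ P Q) (j : Fin n) :
    IsFT σ (oscLo m j P) ((σ * Complex.I) • oscLo m j Q) := by
  convert (h.grDeriv_lo hσ j).add hσ ((h.gen_hi hσ j).smul hσ (1 / 2)) using 1
  · rfl
  · simp only [oscLo, LinearMap.add_apply, LinearMap.smul_apply]
    module

theorem map_oscHi (hσ : σ = 1 ∨ σ = -1) (h : IsFT σ P Q) (j : Fin n) :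
    IsFT σ (oscHi m j P) ((σ * Complex.I) • oscHi m j Q) := by
  convert (h.grDeriv_hi hσ j).sub hσ ((h.gen_lo hσ j).smul hσ (1 / 2)) using 1
  · rfl
  · simp only [oscHi, LinearMap.sub_apply, LinearMap.smul_apply]
    module

theorem map_oscPG (hσ : σ = 1 ∨ σ = -1) (h : IsFT σ P Q) :
    IsFT σ (oscPG m n P) ((σ * Complex.I) ^ 2 • oscPG m n Q) := by
  have key := ((IsFT.sum (I := univ) hσ fun j _ =>
    (h.map_oscHi hσ j).map_oscLo hσ j).smul hσ 4).sub hσ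
    (IsFT.sum (I := univ) hσ fun i _ => (h.map_oscBos hσ i).map_oscBos hσ i)
  convert key using 1
  · rfl
  simp only [oscPG, map_smul, smul_smul, ← Finset.smul_sum]
  module

end IsFT

theorem oscPG_smul (c : ℂ) (P : PG m n) : oscPG m n (c • P) = c • oscPG m n P := by
  simp only [oscPG, map_smul, ← Finset.smul_sum, smul_sub, smul_comm c]

theorem isFT_oscPG_iterate (hσ : σ = 1 ∨ σ = -1) {P : PG m n} {k : ℕ}
    (h : IsFT σ P ((σ * Complex.I) ^ k • P)) (j : ℕ) :
    IsFT σ ((oscPG m n)^[j] P) ((σ * Complex.I) ^ (2 * j + k) • (oscPG m n)^[j] P) := by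
  induction j with
  | zero => simpa using h
  | succ j ih =>
    rw [Function.iterate_succ_apply']
    convert ih.map_oscPG hσ using 1
    rw [oscPG_smul, smul_smul, ← pow_add]
    congr 2
    ring

theorem superLapP_eq (H : PG m n) :
    superLapP m n H = (4 : ℂ) • ∑ j : Fin n, grDeriv m (lo n j) (grDeriv m (hi n j) H) -
      ∑ i, polDeriv n i (polDeriv n i H) := by
  ext1 s
  simp [superLapP, Finset.sum_apply, polDeriv_apply, grDeriv_apply, MvPolynomial.smul_eq_C_mul,
    show (4 : MvPolynomial (Fin m) ℂ) = MvPolynomial.C 4 from (map_ofNat _ 4).symm]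

theorem superLapP_polDeriv (i : Fin m) (H : PG m n) :
    superLapP m n (polDeriv n i H) = polDeriv n i (superLapP m n H) := by
  simp only [superLapP_eq, map_sub, map_smul, map_sum, polDeriv_grDeriv, polDeriv_comm i]

theorem grDeriv_grDeriv_comm (t u v : Fin (2 * n)) (H : PG m n) :
    grDeriv m t (grDeriv m u (grDeriv m v H)) = grDeriv m u (grDeriv m v (grDeriv m t H)) := by
  rw [grDeriv_anticomm t u, grDeriv_anticomm t v, map_neg, neg_neg]

theorem superLapP_grDeriv (t : Fin (2 * n)) (H : PG m n) :
    superLapP m n (grDeriv m t H) = grDeriv m t (superLapP m n H) := by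
  simp only [superLapP_eq, map_sub, map_smul, map_sum, polDeriv_grDeriv,
    grDeriv_grDeriv_comm t]

theorem PHomog.polDeriv {H : PG m n} {k : ℕ} (h : PHomog m n H (k + 1)) (i : Fin m) :
    PHomog m n (polDeriv n i H) k := by
  intro s d hd
  rw [MvPolynomial.mem_support_iff, polDeriv_apply, MvPolynomial.coeff_pderiv] at hd
  have := h s _ (MvPolynomial.mem_support_iff.2 (left_ne_zero_of_mul hd))
  rw [Finsupp.sum_add_index' (fun _ => rfl) (fun _ _ _ => rfl),
    Finsupp.sum_single_index rfl] at this
  omega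

theorem PHomog.grDeriv {H : PG m n} {k : ℕ} (h : PHomog m n H (k + 1)) (t : Fin (2 * n)) :
    PHomog m n (grDeriv m t H) k := by
  intro s d hd
  rw [grDeriv_apply, Gr.pderiv] at hd
  split_ifs at hd with hs
  · simp at hd
  · have hd' : d ∈ (H (insert t s)).support := by
      rcases neg_one_pow_eq_or (MvPolynomial (Fin m) ℂ)
        ((s.filter fun i => i < t).card) with h | h <;> simpa [h] using hd
    have := h _ d hd'
    rw [Finset.card_insert_of_notMem hs] at this
    omega

theorem PHomog.euler {H : PG m n} {k : ℕ} (h : PHomog m n H k) :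
    ∑ i, coordMul n i (_root_.polDeriv n i H) +
      ∑ t, grMul m (Gr.gen t) (_root_.grDeriv m t H) = (k : ℂ) • H := by
  ext1 s
  have hf : (∑ t, grMul m (Gr.gen t) (_root_.grDeriv m t H)) s = s.card • H s := by
    simp only [Finset.sum_apply, grMul_gen, grDeriv_apply, Gr.gen_mul_pderiv_apply]
    simp
  have hs : (H s).IsHomogeneous (k - s.card) := by
    intro d hd
    have := h s d (MvPolynomial.mem_support_iff.2 hd)
    rw [Pi.one_def, ← Finsupp.degree_eq_weight_one, Finsupp.degree_apply]
    rw [Finsupp.sum] at this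
    omega
  have hb : (∑ i, coordMul n i (_root_.polDeriv n i H)) s = (k - s.card) • H s := by
    rw [Finset.sum_apply]
    exact hs.sum_X_mul_pderiv
  rw [Pi.add_apply, hf, hb, ← add_smul, Pi.smul_apply, Nat.cast_smul_eq_nsmul]
  by_cases h0 : H s = 0
  · simp [h0]
  · obtain ⟨d, hd⟩ := MvPolynomial.support_nonempty.2 h0
    have := h s d hd
    congr 1
    omega

theorem PHomog.eq_smul_one {H : PG m n} (h : PHomog m n H 0) :
    ∃ c : ℂ, H = c • Gr.one := by
  refine ⟨(H ∅).coeff 0, ?_⟩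
  ext s d
  by_cases hc : (H s).coeff d = 0
  · by_cases hs : s = ∅
    · subst hs
      by_cases hd : d = 0
      · subst hd; simp [Gr.one]
      · simp [hc, Gr.one, MvPolynomial.coeff_one, Ne.symm hd]
    · simp [hc, Gr.one, hs]
  · have := h s d (MvPolynomial.mem_support_iff.2 hc)
    obtain rfl : s = ∅ := Finset.card_eq_zero.1 (by omega)
    have hd : d = 0 := by
      rw [← Finsupp.degree_eq_zero_iff, Finsupp.degree_apply]
      rw [Finsupp.sum] at this
      omega
    subst hd
    simp [Gr.one]

theorem isFT_coordMul_polDeriv (hσ : σ = 1 ∨ σ = -1) {P : PG m n} {c : ℂ} (i : Fin m)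
    (h : IsFT σ (grMul m (fermGauss n) (polDeriv n i P))
      (c • grMul m (fermGauss n) (polDeriv n i P))) :
    IsFT σ (grMul m (fermGauss n) (coordMul n i (polDeriv n i P)))
      (grMul m (fermGauss n) ((c * (σ * Complex.I)) •
        (coordMul n i (polDeriv n i P) - polDeriv n i (polDeriv n i P)))) := by
  convert h.coordMul hσ i using 1
  · rw [coordMul_grMul]
  · simp only [map_smul, map_sub, coordMul_grMul, polDeriv_grMul]
    module

theorem isFT_gen_lo_grDeriv (hσ : σ = 1 ∨ σ = -1) {P : PG m n} {c : ℂ} (j : Fin n)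
    (h : IsFT σ (grMul m (fermGauss n) (grDeriv m (lo n j) P))
      (c • grMul m (fermGauss n) (grDeriv m (lo n j) P))) :
    IsFT σ (grMul m (fermGauss n) (grMul m (Gr.gen (lo n j)) (grDeriv m (lo n j) P)))
      (grMul m (fermGauss n) ((c * (σ * Complex.I)) •
        (grMul m (Gr.gen (lo n j)) (grDeriv m (lo n j) P) +
          (2 : ℂ) • grDeriv m (lo n j) (grDeriv m (hi n j) P)))) := by
  convert h.gen_lo hσ j using 1
  · rw [grMul_grMul_gen isEven_fermGauss]
  · simp only [map_smul, map_add, grDeriv_hi_grMul_fermGauss, grMul_grMul_gen isEven_fermGauss]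
    rw [grDeriv_anticomm (lo n j), map_neg]
    module

theorem isFT_gen_hi_grDeriv (hσ : σ = 1 ∨ σ = -1) {P : PG m n} {c : ℂ} (j : Fin n)
    (h : IsFT σ (grMul m (fermGauss n) (grDeriv m (hi n j) P))
      (c • grMul m (fermGauss n) (grDeriv m (hi n j) P))) :
    IsFT σ (grMul m (fermGauss n) (grMul m (Gr.gen (hi n j)) (grDeriv m (hi n j) P)))
      (grMul m (fermGauss n) ((c * (σ * Complex.I)) •
        (grMul m (Gr.gen (hi n j)) (grDeriv m (hi n j) P) +
          (2 : ℂ) • grDeriv m (lo n j) (grDeriv m (hi n j) P)))) := by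
  convert h.gen_hi hσ j using 1
  · rw [grMul_grMul_gen isEven_fermGauss]
  · simp only [map_smul, map_add, grDeriv_lo_grMul_fermGauss, grMul_grMul_gen isEven_fermGauss]
    module

/-- Bochner's relation: a super spherical harmonic of degree `k` times the Gaussian is an
eigenfunction with eigenvalue `(±i)^k`. -/
theorem isFT_harmonic (hσ : σ = 1 ∨ σ = -1) {k : ℕ} {H : PG m n} (hhom : PHomog m n H k)
    (hharm : superLapP m n H = 0) :
    IsFT σ (grMul m (fermGauss n) H) ((σ * Complex.I) ^ k • grMul m (fermGauss n) H) := by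
  induction k generalizing H with
  | zero =>
    obtain ⟨c, rfl⟩ := hhom.eq_smul_one
    rw [pow_zero, one_smul, map_smul, grMul_apply, Gr.mul_one]
    exact (isFT_fermGauss hσ).smul hσ c
  | succ k ih =>
    set τ := σ * Complex.I
    have hb (i : Fin m) := isFT_coordMul_polDeriv hσ i
      (ih (hhom.polDeriv i) (by rw [superLapP_polDeriv, hharm, map_zero]))
    have hf (t : Fin (2 * n)) :=
      ih (hhom.grDeriv t) (by rw [superLapP_grDeriv, hharm, map_zero])
    have hlo (j : Fin n) := isFT_gen_lo_grDeriv hσ j (hf (lo n j))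
    have hhi (j : Fin n) := isFT_gen_hi_grDeriv hσ j (hf (hi n j))
    have hsum := (IsFT.sum (I := univ) hσ fun i _ => hb i).add hσ
      (IsFT.sum (I := univ) hσ fun j _ => (hlo j).add hσ (hhi j))
    have hk : (k + 1 : ℂ) ≠ 0 := by exact_mod_cast k.succ_ne_zero
    have heuler := hhom.euler
    rw [sum_lo_hi, Nat.cast_succ] at heuler
    rw [superLapP_eq] at hharm
    have hleft : ((k : ℂ) + 1)⁻¹ • ((k : ℂ) + 1) • grMul m (fermGauss n) H =
        grMul m (fermGauss n) H := by rw [smul_smul, inv_mul_cancel₀ hk, one_smul]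
    rw [← hleft, smul_comm _ (((k : ℂ) + 1)⁻¹)]
    refine IsFT.smul hσ _ ?_
    convert hsum using 1
    · simp only [← map_smul, ← heuler, map_add, map_sum]
    · simp only [← map_add, ← map_sum, ← smul_add, ← Finset.smul_sum]
      rw [← map_smul, ← map_smul]
      congr 1
      simp only [Finset.sum_add_distrib, Finset.sum_sub_distrib, ← Finset.smul_sum] at heuler ⊢
      rw [← heuler, pow_succ]
      rw [sub_eq_zero] at hharm
      rw [← hharm]
      module

end Eigenfunctions

/-- Let `H` be a super spherical harmonic of degree `k`.  Then the functions
`ψ_{j,k} = O^j (H exp(x²/2))`, with `O = Δ + x² + 2𝔼 + M`, are eigenfunctions of the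
super Fourier transform (sign `σ = ±1`):
`F^±_{m|2n}(ψ_{j,k}) = e^{±i(2j+k)π/2} ψ_{j,k} = (±i)^{2j+k} ψ_{j,k}`. -/
theorem superFT_eigenfunctions (m n k : ℕ) (hm : 1 ≤ m) (σ : ℂ)
    (hσ : σ = 1 ∨ σ = -1) (H : PG m n) (hhom : PHomog m n H k)
    (hharm : superLapP m n H = 0) (j : ℕ) :
    superFT m n σ
        ((Oop m n)^[j] (fun x => Gr.mul (evalP m n H x) (gaussFun m n x))) =
      fun y => (σ * Complex.I) ^ (2 * j + k) •
        ((Oop m n)^[j] (fun x => Gr.mul (evalP m n H x) (gaussFun m n x))) y := by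
  rw [← gaussPG_grMul_fermGauss, Oop_iterate_gaussPG,
    isFT_oscPG_iterate hσ (isFT_harmonic hσ hhom hharm) j, map_smul]
  rfl

end
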